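/- arXiv:0712.1081 — 2 statements merged into one kernel-verified Lean document; each statement's English description precedes it below -/
import Mathlib

section
/- Assume the Riemann Hypothesis for all Dirichlet L-functions. For each fixed integer g with |g| ≥ 2 there is a constant C_g such that for all real x ≥ 3, p_g(x) ≤ C_g · I_g(x)² · x⁴. -/
open scoped BigOperators

/-- The finset of primes `p ≤ x`. -/
noncomputable def primesUpTo (x : ℝ) : Finset ℕ := (Finset.Iic ⌊x⌋₊).filter Nat.Prime

/-- `M(x)`: the product of all primes `p ≤ x`. -/
noncomputable def Mx (x : ℝ) : ℕ := ∏ p ∈ primesUpTo x, p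

/-- The Generalized Riemann Hypothesis, rendered here as the Riemann Hypothesis for all
Dirichlet `L`-functions (Mathlib's analytically continued `DirichletCharacter.LFunction`):
every zero `s` with `0 < Re s < 1` lies on the critical line `Re s = 1/2`. -/
def GRH : Prop :=
  ∀ (N : ℕ) [NeZero N] (χ : DirichletCharacter ℂ N) (s : ℂ),
    DirichletCharacter.LFunction χ s = 0 → 0 < s.re → s.re < 1 → s.re = 1 / 2

/-- An `x`-pseudopower to base `g`: a positive integer `n` that is not a power of `g`,
yet is congruent to a power of `g` modulo every prime `p ≤ x`. -/
def IsPseudopower (g : ℤ) (x : ℝ) (n : ℕ) : Prop :=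
  0 < n ∧ (¬ ∃ k : ℕ, (n : ℤ) = g ^ k) ∧
    ∀ p : ℕ, p.Prime → (p : ℝ) ≤ x → ∃ k : ℕ, (n : ℤ) ≡ g ^ k [ZMOD (p : ℕ)]

/-- `q_g(x)`: the least `x`-pseudopower to base `g`. -/
noncomputable def qg (g : ℤ) (x : ℝ) : ℕ := sInf {n : ℕ | IsPseudopower g x n}

/-- `I_g(x) = ∏_{p ≤ x, p ∤ g} i_g(p)`, where `i_g(p) = (p-1)/l_g(p)` is the index of the
subgroup generated by `g` in `(ℤ/pℤ)*` and `l_g(p)` is the multiplicative order of `g` mod `p`. -/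
noncomputable def Ig (g : ℤ) (x : ℝ) : ℕ :=
  ∏ p ∈ (primesUpTo x).filter (fun p : ℕ => ¬ ((p : ℤ) ∣ g)),
    (p - 1) / orderOf ((g : ZMod p))

/-- `p_g(x)`: the least positive integer that is not a power of `g`, yet is congruent to a
power of `g` modulo every prime `p ≤ x` with `p ∤ g`. -/
noncomputable def pg (g : ℤ) (x : ℝ) : ℕ :=
  sInf {n : ℕ | 0 < n ∧ (¬ ∃ k : ℕ, (n : ℤ) = g ^ k) ∧
    ∀ p : ℕ, p.Prime → (p : ℝ) ≤ x → ¬ ((p : ℤ) ∣ g) →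
      ∃ k : ℕ, (n : ℤ) ≡ g ^ k [ZMOD (p : ℕ)]}

section

open Complex MeasureTheory Filter Topology Set

theorem integrable_one_add_sq_rpow : Integrable fun t : ℝ => (1 + t ^ 2) ^ (-(3 / 4) : ℝ) := by
  have h := integrable_rpow_neg_one_add_norm_sq (E := ℝ) (μ := volume) (r := 3 / 2) (by norm_num)
  convert h using 3
  · simp
  · norm_num

theorem tendsto_one_add_sq_rpow :
    Tendsto (fun t : ℝ => (1 + t ^ 2) ^ (-(3 / 4) : ℝ)) atTop (𝓝 0) :=
  (tendsto_rpow_neg_atTop (by norm_num)).comp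
    (tendsto_atTop_add_const_left _ _ (tendsto_pow_atTop two_ne_zero))

theorem continuous_verticalLine (σ : ℝ) : Continuous fun t : ℝ => (σ + t * I : ℂ) := by fun_prop

theorem integrable_verticalLine {G : ℂ → ℂ} {σ c K : ℝ}
    (hG : DifferentiableOn ℂ G {s | s.re ∈ Icc σ c})
    (hK : ∀ s : ℂ, s.re ∈ Icc σ c → ‖G s‖ ≤ K * (1 + s.im ^ 2) ^ (-(3 / 4) : ℝ))
    {r : ℝ} (hr : r ∈ Icc σ c) : Integrable fun t : ℝ => G (r + t * I) := by
  refine (integrable_one_add_sq_rpow.const_mul K).mono' ?_ (Eventually.of_forall fun t => ?_)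
  · refine Continuous.aestronglyMeasurable ?_
    exact hG.continuousOn.comp_continuous (continuous_verticalLine r) fun t => by simpa using hr
  · simpa using hK (r + t * I) (by simpa using hr)

theorem integral_verticalLine_eq {G : ℂ → ℂ} {σ c K : ℝ} (hσc : σ ≤ c)
    (hG : DifferentiableOn ℂ G {s | s.re ∈ Icc σ c})
    (hK : ∀ s : ℂ, s.re ∈ Icc σ c → ‖G s‖ ≤ K * (1 + s.im ^ 2) ^ (-(3 / 4) : ℝ)) :
    ∫ t : ℝ, G (σ + t * I) = ∫ t : ℝ, G (c + t * I) := by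
  have hlim {r : ℝ} (hr : r ∈ Icc σ c) :
      Tendsto (fun T : ℝ => ∫ t in (-T)..T, G (r + t * I)) atTop (𝓝 (∫ t : ℝ, G (r + t * I))) :=
    intervalIntegral_tendsto_integral (integrable_verticalLine hG hK hr)
      tendsto_neg_atTop_atBot tendsto_id
  have hhor (T : ℝ) : ‖∫ x in σ..c, G (x + T * I)‖
      ≤ K * (1 + T ^ 2) ^ (-(3 / 4) : ℝ) * |c - σ| := by
    refine intervalIntegral.norm_integral_le_of_norm_le_const fun x hx => ?_
    rw [uIoc_of_le hσc] at hx
    simpa using hK (x + T * I) (by simpa using ⟨hx.1.le, hx.2⟩)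
  have hrect (T : ℝ) : ‖(∫ t in (-T)..T, G (c + t * I)) - ∫ t in (-T)..T, G (σ + t * I)‖
      ≤ 2 * (K * (1 + T ^ 2) ^ (-(3 / 4) : ℝ) * |c - σ|) := by
    have h := integral_boundary_rect_eq_zero_of_differentiableOn G (σ + (-T : ℝ) * I) (c + T * I)
      (hG.mono fun s hs => by
        rw [mem_reProdIm] at hs
        have := hs.1
        simp only [add_re, ofReal_re, mul_re, I_re, ofReal_im, I_im, mul_zero, mul_one, sub_self,
          add_zero, uIcc_of_le hσc] at this
        exact this)
    simp only [add_re, ofReal_re, mul_re, I_re, ofReal_im, I_im, mul_zero, mul_one, sub_self,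
          add_zero, add_im, mul_im, zero_add, smul_eq_mul] at h
    have h' : I * ((∫ t in (-T)..T, G (c + t * I)) - ∫ t in (-T)..T, G (σ + t * I)) =
        (∫ x in σ..c, G (x + T * I)) - ∫ x in σ..c, G (x + (-T : ℝ) * I) := by
      linear_combination h
    calc _ = ‖I * ((∫ t in (-T)..T, G (c + t * I)) - ∫ t in (-T)..T, G (σ + t * I))‖ := by simp
      _ ≤ _ := by
        rw [h', two_mul]
        refine (norm_sub_le _ _).trans (add_le_add (hhor T) ?_)
        simpa using hhor (-T)
  have hz : Tendsto (fun T : ℝ => (∫ t in (-T)..T, G (c + t * I)) - ∫ t in (-T)..T, G (σ + t * I))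
      atTop (𝓝 0) := by
    refine squeeze_zero_norm hrect ?_
    simpa using (((tendsto_one_add_sq_rpow.const_mul K).mul_const |c - σ|).const_mul 2)
  have := tendsto_nhds_unique hz ((hlim (right_mem_Icc.2 hσc)).sub (hlim (left_mem_Icc.2 hσc)))
  exact (sub_eq_zero.1 this.symm).symm

/-- The Mellin transform of `u ↦ max (1 - u) 0`. -/
noncomputable def cesaroKernel (s : ℂ) : ℂ := 1 / (s * (s + 1))

theorem norm_cesaroKernel_le {d : ℝ} (hd : 0 < d) (hd1 : d ≤ 1) {s : ℂ} (hs : d ≤ s.re) :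
    ‖cesaroKernel s‖ ≤ d⁻¹ ^ 2 / (1 + s.im ^ 2) := by
  have h1 : d ^ 2 * (1 + s.im ^ 2) ≤ ‖s‖ ^ 2 := by
    rw [Complex.sq_norm, normSq_apply]
    nlinarith [mul_nonneg (sub_nonneg.2 hd1) (mul_nonneg (by linarith : 0 ≤ 1 + d) (sq_nonneg s.im))]
  have h2 : ‖s‖ ≤ ‖s + 1‖ := by
    refine (sq_le_sq₀ (norm_nonneg _) (norm_nonneg _)).1 ?_
    rw [Complex.sq_norm, Complex.sq_norm, normSq_apply, normSq_apply]
    simp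
    nlinarith
  have h3 : 0 < d ^ 2 * (1 + s.im ^ 2) := by positivity
  rw [cesaroKernel, norm_div, norm_mul, norm_one, inv_pow, inv_eq_one_div, div_div]
  refine one_div_le_one_div_of_le h3 (h1.trans ?_)
  nlinarith [norm_nonneg s]

theorem differentiableAt_cesaroKernel {s : ℂ} (hs : 0 < s.re) :
    DifferentiableAt ℂ cesaroKernel s := by
  have h0 : s ≠ 0 := fun h => by simp [h] at hs
  have h1 : s + 1 ≠ 0 := fun h => by
    have := congrArg re h
    simp at this
    linarith
  unfold cesaroKernel
  fun_prop (disch := exact mul_ne_zero h0 h1)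

theorem hasMellin_max_one_sub {s : ℂ} (hs : 0 < s.re) :
    HasMellin (fun u : ℝ => ((max (1 - u) 0 : ℝ) : ℂ)) s (cesaroKernel s) := by
  have h0 : s ≠ 0 := fun h => by simp [h] at hs
  have h1 : s + 1 ≠ 0 := fun h => by
    have := congrArg re h
    simp at this
    linarith
  have hA := hasMellin_one_Ioc hs
  have hB := hasMellin_cpow_Ioc 1 (s := s) (by simp; linarith)
  have h := hasMellin_sub hA.1 hB.1
  rw [hA.2, hB.2] at h
  have hk : cesaroKernel s = 1 / s - 1 / (s + 1) := by
    rw [cesaroKernel]; field_simp; ring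
  rw [hk]
  have hf : (fun u : ℝ => (indicator (Ioc 0 1) (fun _ => 1 : ℝ → ℂ)) u -
      (indicator (Ioc 0 1) (fun t => (t : ℂ) ^ (1 : ℂ) : ℝ → ℂ)) u) =
      fun u : ℝ => if u ∈ Ioc (0 : ℝ) 1 then (1 - u : ℂ) else 0 := by
    ext u
    by_cases hu : u ∈ Ioc (0 : ℝ) 1 <;> simp [hu]
  have heq : EqOn (fun u : ℝ => if u ∈ Ioc (0 : ℝ) 1 then (1 - u : ℂ) else 0)
      (fun u : ℝ => ((max (1 - u) 0 : ℝ) : ℂ)) (Ioi 0) := by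
    intro u hu
    rw [mem_Ioi] at hu
    by_cases h : u ≤ 1
    · simp [hu, h]
    · have : max (1 - u) 0 = 0 := max_eq_right (by linarith)
      simp [h, this]
  rw [hf] at h
  refine ⟨h.1.congr_fun (fun u hu => ?_) measurableSet_Ioi, ?_⟩
  · exact congrArg (fun z => (u : ℂ) ^ (s - 1) • z) (heq hu)
  · rw [← h.2]
    refine setIntegral_congr_fun measurableSet_Ioi fun u hu => ?_
    exact congrArg (fun z => (u : ℂ) ^ (s - 1) • z) (heq hu).symm

theorem integrable_cesaroKernel {σ : ℝ} (hσ : 0 < σ) :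
    Integrable fun t : ℝ => cesaroKernel (σ + t * I) := by
  have hd : 0 < min σ 1 := lt_min hσ one_pos
  refine (integrable_inv_one_add_sq.const_mul ((min σ 1)⁻¹ ^ 2)).mono' ?_
    (Eventually.of_forall fun t => ?_)
  · refine Continuous.aestronglyMeasurable (continuous_iff_continuousAt.2 fun t => ?_)
    exact ContinuousAt.comp (f := fun t : ℝ => (σ + t * I : ℂ))
      (differentiableAt_cesaroKernel (by simpa using hσ)).continuousAt
      (continuous_verticalLine σ).continuousAt
  · simpa [div_eq_mul_inv] using norm_cesaroKernel_le hd (min_le_right _ _) (s := σ + t * I) (by simp)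

theorem integral_cpow_mul_cesaroKernel {σ u : ℝ} (hσ : 0 < σ) (hu : 0 < u) :
    ∫ t : ℝ, (u : ℂ) ^ (-(σ + t * I)) * cesaroKernel (σ + t * I) =
      2 * Real.pi * (max (1 - u) 0 : ℝ) := by
  have hm (t : ℝ) : mellin (fun u : ℝ => ((max (1 - u) 0 : ℝ) : ℂ)) (σ + t * I) =
      cesaroKernel (σ + t * I) := (hasMellin_max_one_sub (by simpa using hσ)).2
  have h := mellinInv_mellin_eq σ (fun u : ℝ => ((max (1 - u) 0 : ℝ) : ℂ)) hu
    (hasMellin_max_one_sub (by simpa using hσ)).1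
    ((integrable_cesaroKernel hσ).congr (Eventually.of_forall fun t => (hm t).symm))
    (by fun_prop)
  simp only [mellinInv, hm, smul_eq_mul] at h
  generalize ∫ t : ℝ, (u : ℂ) ^ (-(σ + t * I)) * cesaroKernel (σ + t * I) = J at h ⊢
  have hpi : (Real.pi : ℂ) ≠ 0 := by exact_mod_cast Real.pi_ne_zero
  rw [← h, real_smul]
  push_cast
  field_simp

theorem hasSum_integral_LSeries_mul {a : ℕ → ℂ} (ha : ∀ n, ‖a n‖ ≤ 1) {c : ℝ} (hc : 1 < c)
    {k : ℝ → ℂ} (hk : Integrable k) :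
    HasSum (fun n => ∫ t : ℝ, LSeries.term a (c + t * I) n * k t)
      (∫ t : ℝ, LSeries a (c + t * I) * k t) := by
  have hle (n : ℕ) (t : ℝ) : ‖LSeries.term a (c + t * I) n‖ ≤ (n : ℝ) ^ (-c) := by
    rw [LSeries.norm_term_eq]
    split_ifs with h
    · positivity
    · simp only [add_re, ofReal_re, mul_re, I_re, ofReal_im, I_im, mul_zero, mul_one, sub_self,
        add_zero]
      rw [Real.rpow_neg (by positivity), div_eq_mul_inv]
      exact mul_le_of_le_one_left (by positivity) (ha n)
  have hcont (n : ℕ) : Continuous fun t : ℝ => LSeries.term a (c + t * I) n := by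
    rcases eq_or_ne n 0 with rfl | h
    · simpa using continuous_const
    · simp only [LSeries.term_of_ne_zero h]
      refine Continuous.div continuous_const ?_ fun t => ?_
      · exact Continuous.const_cpow (by fun_prop) (Or.inl (by exact_mod_cast h))
      · exact (cpow_ne_zero_iff_of_exponent_ne_zero fun h0 => by
          have := congrArg re h0; simp at this; linarith).2 (by exact_mod_cast h)
  have hinteg (n : ℕ) : Integrable fun t : ℝ => LSeries.term a (c + t * I) n * k t :=
    hk.bdd_mul (hcont n).aestronglyMeasurable (Eventually.of_forall (hle n))
  have h := hasSum_integral_of_summable_integral_norm hinteg ?_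
  · simpa only [LSeries, tsum_mul_right] using h
  refine Summable.of_nonneg_of_le (fun n => integral_nonneg fun t => norm_nonneg _)
    (fun n => ?_) ((Real.summable_nat_rpow.2 (neg_lt_neg hc)).mul_right (∫ t, ‖k t‖))
  rw [← integral_const_mul]
  refine integral_mono (hinteg n).norm (hk.norm.const_mul _) fun t => ?_
  simp only [norm_mul]
  gcongr
  exact hle n t

theorem integral_LSeries_mul_cesaroKernel {a : ℕ → ℂ} (ha : ∀ n, ‖a n‖ ≤ 1) {c y : ℝ} (hc : 1 < c)
    (hy : 0 < y) :
    ∫ t : ℝ, LSeries a (c + t * I) * ((y : ℂ) ^ (c + t * I : ℂ) * cesaroKernel (c + t * I)) =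
      2 * Real.pi * ∑ n ∈ Finset.Icc 1 ⌊y⌋₊, a n * (1 - n / y) := by
  have hk : Integrable fun t : ℝ => (y : ℂ) ^ (c + t * I : ℂ) * cesaroKernel (c + t * I) := by
    refine (integrable_cesaroKernel (by linarith)).bdd_mul (c := y ^ c)
      (Continuous.aestronglyMeasurable ?_) (Eventually.of_forall fun t => ?_)
    · exact Continuous.const_cpow (by fun_prop) (Or.inl (by exact_mod_cast hy.ne'))
    · rw [norm_cpow_eq_rpow_re_of_pos hy]; simp
  have h := hasSum_integral_LSeries_mul ha hc hk
  have hterm (n : ℕ) : ∫ t : ℝ, LSeries.term a (c + t * I) n *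
      ((y : ℂ) ^ (c + t * I : ℂ) * cesaroKernel (c + t * I)) =
      if n = 0 then 0 else 2 * Real.pi * (a n * (max (1 - n / y) 0 : ℝ)) := by
    split_ifs with hn
    · simp [hn]
    · have hn' : (0 : ℝ) < n := by exact_mod_cast Nat.pos_of_ne_zero hn
      have key := integral_cpow_mul_cesaroKernel (σ := c) (by linarith) (div_pos hn' hy)
      rw [show 2 * Real.pi * (a n * (max (1 - n / y) 0 : ℝ)) =
        a n * (2 * Real.pi * (max (1 - n / y) 0 : ℝ)) by ring, ← key, ← integral_const_mul]
      refine integral_congr_ae (Eventually.of_forall fun t => ?_)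
      simp only [LSeries.term_of_ne_zero hn]
      have : ((n / y : ℝ) : ℂ) ^ (-(c + t * I) : ℂ) =
          (n : ℂ) ^ (-(c + t * I) : ℂ) * (y : ℂ) ^ (c + t * I : ℂ) := by
        rw [ofReal_div, div_eq_mul_inv, ← ofReal_inv,
          mul_cpow_ofReal_nonneg hn'.le (inv_pos.2 hy).le, ofReal_inv, inv_cpow, cpow_neg (y : ℂ),
          inv_inv, ofReal_natCast]
        rw [arg_ofReal_of_nonneg hy.le]; exact Real.pi_pos.ne
      rw [this, cpow_neg]
      ring
  simp only [hterm] at h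
  refine h.unique ?_
  rw [Finset.mul_sum]
  have hs : ∀ n ∈ Finset.Icc 1 ⌊y⌋₊, 2 * Real.pi * (a n * (1 - n / y)) =
      if n = 0 then 0 else 2 * Real.pi * (a n * (max (1 - n / y) 0 : ℝ)) := by
    intro n hn
    rw [Finset.mem_Icc] at hn
    have h2 : (n : ℝ) ≤ y := (Nat.le_floor_iff hy.le).1 hn.2
    rw [if_neg (by omega), max_eq_left (by rw [sub_nonneg]; exact (div_le_one hy).2 h2)]
    push_cast
    rfl
  rw [Finset.sum_congr rfl hs]
  refine hasSum_sum_of_ne_finset_zero fun n hn => ?_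
  split_ifs with h0
  · rfl
  · rw [Finset.mem_Icc, not_and, not_le] at hn
    have h2 : y < n := (Nat.floor_lt hy.le).1 (hn (by omega))
    rw [max_eq_right (by rw [sub_nonpos]; exact (one_le_div hy).2 h2.le)]
    simp

theorem LSeriesSummable_of_norm_le_one {a : ℕ → ℂ} (ha : ∀ n, ‖a n‖ ≤ 1) {s : ℂ} (hs : 1 < s.re) :
    LSeriesSummable a s :=
  LSeriesSummable_of_bounded_of_one_lt_re (m := 1) (fun n _ => ha n) hs

theorem integral_term_mul_cesaroKernel_reflected (a : ℕ → ℂ) (c : ℝ) {d y : ℝ} (hd : 0 < d)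
    (hy : 1 ≤ y) (n : ℕ) :
    ∫ t : ℝ, LSeries.term a (c + t * I) n *
      ((y : ℂ) ^ (d - t * I : ℂ) * cesaroKernel (d - t * I)) =
      2 * Real.pi * (LSeries.term a (c + d) n - y⁻¹ * LSeries.term a (c + d + 1) n) := by
  have hy0 : 0 < y := by linarith
  rcases eq_or_ne n 0 with hn | hn
  · simp [hn]
  · have hn1 : (1 : ℝ) ≤ n := by exact_mod_cast Nat.pos_of_ne_zero hn
    have hn' : (0 : ℝ) < n := by linarith
    have hnC : (n : ℂ) ≠ 0 := by exact_mod_cast hn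
    have hny : 0 < n * y := mul_pos hn' hy0
    have key := integral_cpow_mul_cesaroKernel (σ := d) hd (inv_pos.2 hny)
    have hmax : max (1 - (n * y)⁻¹) 0 = 1 - (n * y)⁻¹ :=
      max_eq_left (sub_nonneg.2 (inv_le_one_of_one_le₀ (by nlinarith)))
    rw [hmax] at key
    have e : 2 * Real.pi * (LSeries.term a (c + d) n - y⁻¹ * LSeries.term a (c + d + 1) n) =
        a n * (n : ℂ) ^ (-(c + d) : ℂ) * (2 * Real.pi * (1 - (n * y)⁻¹ : ℝ)) := by
      simp only [LSeries.term_of_ne_zero hn, cpow_neg]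
      rw [cpow_add (c + d : ℂ) 1 hnC, cpow_one]
      push_cast
      rw [mul_inv]
      ring
    rw [e, ← key, ← integral_const_mul, ← integral_neg_eq_self]
    refine integral_congr_ae (Eventually.of_forall fun t => ?_)
    simp only [LSeries.term_of_ne_zero hn]
    have : (((n * y)⁻¹ : ℝ) : ℂ) ^ (-(d + t * I) : ℂ) =
        (n : ℂ) ^ (d + t * I : ℂ) * (y : ℂ) ^ (d + t * I : ℂ) := by
      rw [ofReal_inv, inv_cpow, cpow_neg, inv_inv, ofReal_mul,
        mul_cpow_ofReal_nonneg hn'.le hy0.le, ofReal_natCast]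
      rw [arg_ofReal_of_nonneg hny.le]; exact Real.pi_pos.ne
    rw [this]
    have h3 : (n : ℂ) ^ (-(c + d) : ℂ) * (n : ℂ) ^ (d + t * I : ℂ) =
        ((n : ℂ) ^ (c + (-t : ℝ) * I : ℂ))⁻¹ := by
      rw [← cpow_add _ _ hnC, ← cpow_neg]
      congr 1
      push_cast
      ring
    rw [div_eq_mul_inv, ← h3]
    have h4 : (d - (-t : ℝ) * I : ℂ) = d + t * I := by push_cast; ring
    rw [h4]
    ring

theorem integral_LSeries_mul_cesaroKernel_reflected {a : ℕ → ℂ} (ha : ∀ n, ‖a n‖ ≤ 1) {c d y : ℝ}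
    (hc : 1 < c) (hd : 0 < d) (hy : 1 ≤ y) :
    ∫ t : ℝ, LSeries a (c + t * I) * ((y : ℂ) ^ (d - t * I : ℂ) * cesaroKernel (d - t * I)) =
      2 * Real.pi * (LSeries a (c + d) - y⁻¹ * LSeries a (c + d + 1)) := by
  have hy0 : 0 < y := by linarith
  have hk : Integrable fun t : ℝ => (y : ℂ) ^ (d - t * I : ℂ) * cesaroKernel (d - t * I) := by
    have h0 : Integrable fun t : ℝ => cesaroKernel (d - t * I) := by
      simpa [sub_eq_add_neg] using (integrable_cesaroKernel hd).comp_neg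
    refine h0.bdd_mul (c := y ^ d)
      (Continuous.aestronglyMeasurable ?_) (Eventually.of_forall fun t => ?_)
    · exact Continuous.const_cpow (by fun_prop) (Or.inl (by exact_mod_cast hy0.ne'))
    · rw [norm_cpow_eq_rpow_re_of_pos hy0]; simp
  have h := hasSum_integral_LSeries_mul ha hc hk
  simp only [integral_term_mul_cesaroKernel_reflected a c hd hy] at h
  refine h.unique ?_
  have h1 : HasSum (LSeries.term a (c + d)) (LSeries a (c + d)) :=
    (LSeriesSummable_of_norm_le_one ha (s := c + d) (by simp; linarith)).LSeriesHasSum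
  have h2 : HasSum (LSeries.term a (c + d + 1)) (LSeries a (c + d + 1)) :=
    (LSeriesSummable_of_norm_le_one ha (s := c + d + 1) (by simp; linarith)).LSeriesHasSum
  exact (HasSum.sub h1 (HasSum.mul_left ((y⁻¹ : ℝ) : ℂ) h2)).mul_left (2 * Real.pi : ℂ)

theorem log_six_add_abs_le (t : ℝ) : Real.log (6 + |t|) ≤ 18 * (1 + t ^ 2) ^ (1 / 4 : ℝ) := by
  have h1 : Real.log (6 + |t|) ≤ (6 + |t|) ^ (1 / 2 : ℝ) / (1 / 2) :=
    Real.log_le_rpow_div (by positivity) (by norm_num)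
  have h2 : (6 + |t|) ^ (1 / 2 : ℝ) ≤ 9 * (1 + t ^ 2) ^ (1 / 4 : ℝ) := by
    have e : (6 + |t|) ^ (1 / 2 : ℝ) = ((6 + |t|) ^ (2 : ℝ)) ^ (1 / 4 : ℝ) := by
      rw [← Real.rpow_mul (by positivity)]; norm_num
    have e9 : (9 : ℝ) = ((9 : ℝ) ^ (4 : ℝ)) ^ (1 / 4 : ℝ) := by
      rw [← Real.rpow_mul (by positivity)]; norm_num
    rw [e, e9, ← Real.mul_rpow (by positivity) (by positivity)]
    refine Real.rpow_le_rpow (by positivity) ?_ (by norm_num)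
    have h94 : (9 : ℝ) ^ (4 : ℝ) = 6561 := by
      rw [show (4 : ℝ) = (4 : ℕ) by norm_num, Real.rpow_natCast]; norm_num
    rw [Real.rpow_two, h94]
    nlinarith [sq_abs t, sq_nonneg (|t| - 1), abs_nonneg t]
  linarith

theorem norm_LSeries_le_two {a : ℕ → ℂ} (ha : ∀ n, ‖a n‖ ≤ 1) {s : ℂ} (hs : 2 ≤ s.re) :
    ‖LSeries a s‖ ≤ 2 := by
  have hz := hasSum_zeta_two
  have hle (n : ℕ) : ‖LSeries.term a s n‖ ≤ 1 / (n : ℝ) ^ 2 := by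
    rw [LSeries.norm_term_eq]
    split_ifs with h
    · positivity
    · have h1 : (1 : ℝ) ≤ n := by exact_mod_cast Nat.pos_of_ne_zero h
      have h2 : (n : ℝ) ^ 2 ≤ (n : ℝ) ^ s.re := by
        rw [← Real.rpow_two]; exact Real.rpow_le_rpow_of_exponent_le h1 hs
      have : (0 : ℝ) < (n : ℝ) ^ 2 := by positivity
      exact div_le_div₀ zero_le_one (ha n) this h2
  refine (tsum_of_norm_bounded hz hle).trans ?_
  nlinarith [Real.pi_lt_d2, Real.pi_pos]

/-- The analytic situation of a logarithm of an `L`-function without zeros in `re s > 1 / 2`: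
`F` is holomorphic there, is given by a Dirichlet series with coefficients bounded by `1` on
`re s > 1`, and has real part growing at most logarithmically. -/
structure IsLogOfLSeries (a : ℕ → ℂ) (F : ℂ → ℂ) (A : ℝ) : Prop where
  norm_coeff_le : ∀ n, ‖a n‖ ≤ 1
  differentiableOn : DifferentiableOn ℂ F {s | 1 / 2 < s.re}
  eq_LSeries : ∀ s : ℂ, 1 < s.re → F s = LSeries a s
  nonneg : 0 ≤ A
  re_le : ∀ s : ℂ, 1 / 2 < s.re → (F s).re ≤ A + Real.log (1 + ‖s‖)

namespace IsLogOfLSeries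

variable {a : ℕ → ℂ} {F : ℂ → ℂ} {A : ℝ}

theorem norm_le (h : IsLogOfLSeries a F A) {s : ℂ} (hs : 1 / 2 < s.re) (hs2 : s.re ≤ 2) :
    ‖F s‖ ≤ (3 * (A + Real.log (6 + |s.im|)) + 6) / (s.re - 1 / 2) := by
  set w : ℂ := 2 + s.im * I with hw
  have hM : 0 < A + Real.log (6 + |s.im|) :=
    add_pos_of_nonneg_of_pos h.nonneg (Real.log_pos (by linarith [abs_nonneg s.im]))
  have hre (z : ℂ) (hz : z ∈ Metric.ball (0 : ℂ) (3 / 2)) : 1 / 2 < (w + z).re := by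
    have h1 : |z.re| < 3 / 2 := (abs_re_le_norm z).trans_lt (mem_ball_zero_iff.1 hz)
    have h2 := (abs_lt.1 h1).1
    simp [hw]
    linarith
  have hz : s - w = ((s.re - 2 : ℝ) : ℂ) := by
    apply Complex.ext <;> simp [hw]
  have hzn : ‖s - w‖ = 2 - s.re := by
    rw [hz, norm_real, Real.norm_eq_abs, abs_of_nonpos (by linarith)]; ring
  have hb := borelCaratheodory (f := fun z => F (w + z)) (R := 3 / 2) (z := s - w) hM
    (h.differentiableOn.comp (by fun_prop) fun z hz => hre z hz)
    (fun z hz => by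
      refine (h.re_le _ (hre z hz)).trans ?_
      have : ‖w + z‖ ≤ 5 + |s.im| := by
        have h1 : ‖w‖ ≤ 2 + |s.im| := by
          refine (norm_add_le _ _).trans ?_
          simp
        have h2 := mem_ball_zero_iff.1 hz
        linarith [norm_add_le w z]
      have h3 : Real.log (1 + ‖w + z‖) ≤ Real.log (6 + |s.im|) :=
        Real.log_le_log (by positivity) (by linarith)
      linarith) (by norm_num)
    (by rw [mem_ball_zero_iff, hzn]; linarith)
  have hw2 : ‖F w‖ ≤ 2 := by
    rw [h.eq_LSeries w (by simp [hw])]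
    exact norm_LSeries_le_two h.norm_coeff_le (by simp [hw])
  simp only [add_sub_cancel, add_zero, hzn] at hb
  have hd : 0 < s.re - 1 / 2 := by linarith
  rw [show 3 / 2 - (2 - s.re) = s.re - 1 / 2 by ring, ← add_div] at hb
  refine hb.trans (div_le_div_of_nonneg_right ?_ hd.le)
  have h1 : 2 * (A + Real.log (6 + |s.im|)) * (2 - s.re) ≤ 3 * (A + Real.log (6 + |s.im|)) := by
    nlinarith
  have h2 : ‖F w‖ * (3 / 2 + (2 - s.re)) ≤ 6 := by nlinarith [norm_nonneg (F w)]
  linarith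

theorem exists_norm_le (h : IsLogOfLSeries a F A) {σ : ℝ} (hσ : 1 / 2 < σ) :
    ∃ K, 0 ≤ K ∧ ∀ s : ℂ, s.re ∈ Icc σ 2 → ‖F s‖ ≤ K * (1 + s.im ^ 2) ^ (1 / 4 : ℝ) := by
  have hA := h.nonneg
  have hd : 0 < σ - 1 / 2 := by linarith
  refine ⟨(3 * (A + 18) + 6) / (σ - 1 / 2), by positivity, fun s hs => ?_⟩
  refine (h.norm_le (hσ.trans_le hs.1) hs.2).trans ?_
  have h1 : 1 ≤ (1 + s.im ^ 2) ^ (1 / 4 : ℝ) :=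
    Real.one_le_rpow (by nlinarith [sq_nonneg s.im]) (by norm_num)
  have h2 := log_six_add_abs_le s.im
  rw [div_mul_eq_mul_div]
  refine div_le_div₀ (by positivity) ?_ hd (by linarith [hs.1])
  nlinarith [mul_nonneg hA (sub_nonneg.2 h1)]

theorem norm_mul_le {K B : ℝ} (hK : 0 ≤ K) {s u v : ℂ}
    (hu : ‖u‖ ≤ K * (1 + s.im ^ 2) ^ (1 / 4 : ℝ)) (hv : ‖v‖ ≤ B / (1 + s.im ^ 2)) :
    ‖u * v‖ ≤ K * B * (1 + s.im ^ 2) ^ (-(3 / 4) : ℝ) := by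
  have hp : 0 < 1 + s.im ^ 2 := by positivity
  have e : (1 + s.im ^ 2) ^ (-(3 / 4) : ℝ) = (1 + s.im ^ 2) ^ (1 / 4 : ℝ) / (1 + s.im ^ 2) := by
    rw [show (-(3 / 4) : ℝ) = 1 / 4 - 1 by norm_num, Real.rpow_sub_one hp.ne']
  rw [norm_mul, e]
  calc _ ≤ (K * (1 + s.im ^ 2) ^ (1 / 4 : ℝ)) * (B / (1 + s.im ^ 2)) :=
        mul_le_mul hu hv (norm_nonneg _) (by positivity)
    _ = _ := by ring

theorem integrable_and_integral_eq (h : IsLogOfLSeries a F A) {σ c B : ℝ} {k : ℂ → ℂ}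
    (hσ : 1 / 2 < σ) (hσc : σ ≤ c) (hc : c ≤ 2) (hk : DifferentiableOn ℂ k {s | s.re ∈ Icc σ c})
    (hB : ∀ s : ℂ, s.re ∈ Icc σ c → ‖k s‖ ≤ B / (1 + s.im ^ 2)) :
    Integrable (fun t : ℝ => F (σ + t * I) * k (σ + t * I)) ∧
      ∫ t : ℝ, F (σ + t * I) * k (σ + t * I) = ∫ t : ℝ, F (c + t * I) * k (c + t * I) := by
  obtain ⟨K, hK, hF⟩ := h.exists_norm_le hσ
  have hd : DifferentiableOn ℂ (fun s => F s * k s) {s | s.re ∈ Icc σ c} :=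
    (h.differentiableOn.mono fun s hs => hσ.trans_le hs.1).mul hk
  have hb (s : ℂ) (hs : s.re ∈ Icc σ c) :
      ‖F s * k s‖ ≤ K * B * (1 + s.im ^ 2) ^ (-(3 / 4) : ℝ) :=
    norm_mul_le hK (hF s ⟨hs.1, hs.2.trans hc⟩) (hB s hs)
  exact ⟨integrable_verticalLine hd hb (left_mem_Icc.2 hσc), integral_verticalLine_eq hσc hd hb⟩

end IsLogOfLSeries

/-- The integral of `(1 + t ^ 2) ^ (-3 / 4)` over the line. -/
noncomputable def tailIntegral : ℝ := ∫ t : ℝ, (1 + t ^ 2) ^ (-(3 / 4) : ℝ)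

theorem tailIntegral_nonneg : 0 ≤ tailIntegral := integral_nonneg fun t => by positivity

namespace IsLogOfLSeries

variable {a : ℕ → ℂ} {F : ℂ → ℂ} {A : ℝ}

theorem integrable_re_and_integral_abs_re_le (h : IsLogOfLSeries a F A) {σ : ℝ} (hσ : 1 / 2 < σ)
    (hσ1 : σ ≤ 1) :
    Integrable (fun t : ℝ => |(F (σ + t * I)).re| / (9 + t ^ 2)) ∧
    ∫ t : ℝ, |(F (σ + t * I)).re| / (9 + t ^ 2) ≤
      2 * A * Real.pi + 36 * tailIntegral + 2 * Real.pi := by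
  set k : ℂ → ℂ := fun s => 1 / ((3 - (s - σ)) * (3 + (s - σ))) with hkdef
  have hlow {z : ℂ} (hz : 1 ≤ z.re) : 1 + z.im ^ 2 ≤ ‖z‖ ^ 2 := by
    rw [Complex.sq_norm, normSq_apply]; nlinarith
  have hden (s : ℂ) (hs : s.re ∈ Icc σ 2) :
      1 + s.im ^ 2 ≤ ‖(3 - (s - σ)) * (3 + (s - σ))‖ := by
    have h1 := hlow (z := 3 - (s - σ)) (by simp; linarith [hs.2])
    have h2 := hlow (z := 3 + (s - σ)) (by simp; linarith [hs.1])
    simp at h1 h2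
    rw [norm_mul]
    refine (sq_le_sq₀ (by positivity) (by positivity)).1 ?_
    rw [mul_pow, sq (1 + s.im ^ 2)]
    exact mul_le_mul h1 h2 (by positivity) (by positivity)
  have hB (s : ℂ) (hs : s.re ∈ Icc σ 2) : ‖k s‖ ≤ 1 / (1 + s.im ^ 2) := by
    rw [hkdef]
    simp only [norm_div, norm_one]
    exact one_div_le_one_div_of_le (by positivity) (hden s hs)
  have hk : DifferentiableOn ℂ k {s | s.re ∈ Icc σ 2} := by
    intro s hs
    have h0 : (3 - (s - σ)) * (3 + (s - σ)) ≠ 0 := by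
      rw [← norm_pos_iff]
      exact lt_of_lt_of_le (by positivity) (hden s hs)
    refine DifferentiableAt.differentiableWithinAt ?_
    exact (differentiableAt_const _).div (by fun_prop) h0
  obtain ⟨hinteg, heq⟩ := h.integrable_and_integral_eq hσ (by linarith) le_rfl hk hB
  have hkline (t : ℝ) : k (σ + t * I) = ((1 / (9 + t ^ 2) : ℝ) : ℂ) := by
    simp only [hkdef]
    push_cast
    congr 1
    linear_combination (-t ^ 2 : ℂ) * I_sq
  have hmain : ‖∫ t : ℝ, F (σ + t * I) * k (σ + t * I)‖ ≤ 2 * Real.pi := by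
    rw [heq, ← integral_univ_inv_one_add_sq, ← integral_const_mul]
    refine norm_integral_le_of_norm_le (integrable_inv_one_add_sq.const_mul 2)
      (Eventually.of_forall fun t => ?_)
    rw [norm_mul]
    have h1 : ‖F ((2 : ℝ) + t * I)‖ ≤ 2 := by
      rw [h.eq_LSeries _ (by simp)]
      exact norm_LSeries_le_two h.norm_coeff_le (by simp)
    have h2 := hB ((2 : ℝ) + t * I) (by simp; linarith)
    refine mul_le_mul h1 ?_ (norm_nonneg _) zero_le_two
    simpa using h2
  have hre (t : ℝ) : (F (σ + t * I) * k (σ + t * I)).re = (F (σ + t * I)).re / (9 + t ^ 2) := by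
    rw [hkline, re_mul_ofReal, one_div, div_eq_mul_inv]
  have hintre : Integrable fun t : ℝ => (F (σ + t * I)).re / (9 + t ^ 2) := by
    exact hinteg.re.congr (Eventually.of_forall fun t => hre t)
  have hintegral : -(∫ t : ℝ, (F (σ + t * I)).re / (9 + t ^ 2)) ≤ 2 * Real.pi := by
    have e : ∫ t : ℝ, (F (σ + t * I)).re / (9 + t ^ 2) =
        (∫ t : ℝ, F (σ + t * I) * k (σ + t * I)).re := by
      simp only [← hre]
      exact integral_re hinteg
    rw [e]
    exact (neg_le_abs _).trans ((abs_re_le_norm _).trans hmain)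
  have hlog (t : ℝ) : Real.log (1 + ‖(σ + t * I : ℂ)‖) / (9 + t ^ 2) ≤
      18 * (1 + t ^ 2) ^ (-(3 / 4) : ℝ) := by
    have hp : 0 < 1 + t ^ 2 := by positivity
    have e : (1 + t ^ 2) ^ (-(3 / 4) : ℝ) = (1 + t ^ 2) ^ (1 / 4 : ℝ) / (1 + t ^ 2) := by
      rw [show (-(3 / 4) : ℝ) = 1 / 4 - 1 by norm_num, Real.rpow_sub_one hp.ne']
    rw [e, ← mul_div_assoc]
    refine div_le_div₀ (by positivity) (le_trans ?_ (log_six_add_abs_le t)) hp (by linarith)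
    refine Real.log_le_log (by positivity) ?_
    have := norm_add_le (σ : ℂ) (t * I)
    simp [abs_of_pos (by linarith : (0 : ℝ) < σ)] at this
    linarith
  have hpt (t : ℝ) : |(F (σ + t * I)).re| / (9 + t ^ 2) ≤
      2 * A * (1 + t ^ 2)⁻¹ + 36 * (1 + t ^ 2) ^ (-(3 / 4) : ℝ) -
        (F (σ + t * I)).re / (9 + t ^ 2) := by
    have hA := h.nonneg
    have h1 := h.re_le (σ + t * I) (by simpa using hσ)
    have h2 : 0 ≤ Real.log (1 + ‖(σ + t * I : ℂ)‖) :=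
      Real.log_nonneg (by linarith [norm_nonneg (σ + t * I : ℂ)])
    have h3 : |(F (σ + t * I)).re| ≤ 2 * A + 2 * Real.log (1 + ‖(σ + t * I : ℂ)‖) -
        (F (σ + t * I)).re := by
      rcases abs_cases (F (σ + t * I)).re with ⟨h4, _⟩ | ⟨h4, _⟩ <;> rw [h4] <;> linarith
    have hp : 0 < 9 + t ^ 2 := by positivity
    have h5 := div_le_div_of_nonneg_right h3 hp.le
    have h6 : 2 * A / (9 + t ^ 2) ≤ 2 * A * (1 + t ^ 2)⁻¹ := by
      rw [← div_eq_mul_inv]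
      exact div_le_div_of_nonneg_left (by positivity) (by positivity) (by linarith)
    rw [sub_div, add_div, mul_div_assoc 2 (Real.log _)] at h5
    linarith [hlog t]
  have hadd : Integrable fun t : ℝ => 2 * A * (1 + t ^ 2)⁻¹ + 36 * (1 + t ^ 2) ^ (-(3 / 4) : ℝ) :=
    (integrable_inv_one_add_sq.const_mul _).add (integrable_one_add_sq_rpow.const_mul _)
  have hdom : Integrable fun t : ℝ => 2 * A * (1 + t ^ 2)⁻¹ +
      36 * (1 + t ^ 2) ^ (-(3 / 4) : ℝ) - (F (σ + t * I)).re / (9 + t ^ 2) := hadd.sub hintre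
  have habs : Integrable fun t : ℝ => |(F (σ + t * I)).re| / (9 + t ^ 2) := by
    refine hintre.abs.congr (Eventually.of_forall fun t => ?_)
    simp only [abs_div]
    rw [abs_of_pos (by positivity : 0 < 9 + t ^ 2)]
  refine ⟨habs, (integral_mono habs hdom hpt).trans ?_⟩
  rw [integral_sub hadd hintre,
    integral_add (integrable_inv_one_add_sq.const_mul _) (integrable_one_add_sq_rpow.const_mul _),
    integral_const_mul, integral_const_mul, integral_univ_inv_one_add_sq]
  rw [tailIntegral]
  linarith

theorem norm_sum_le_rpow (h : IsLogOfLSeries a F A) {σ y : ℝ} (hσ : 1 / 2 < σ) (hσ1 : σ ≤ 3 / 4)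
    (hy : 1 ≤ y) :
    ‖∑ n ∈ Finset.Icc 1 ⌊y⌋₊, a n * (1 - n / y)‖ ≤
      (72 * (A + 18 * tailIntegral + 1) + (6 * A + 26)) * y ^ σ := by
  have hy0 : 0 < y := by linarith
  have hA := h.nonneg
  have hyC : (y : ℂ) ≠ 0 := by exact_mod_cast hy0.ne'
  set T := ∑ n ∈ Finset.Icc 1 ⌊y⌋₊, a n * (1 - n / y) with hT
  set c := σ + 1 / 2 with hc
  set d := σ - 1 / 2 with hd
  have hd0 : 0 < d := by linarith
  set E := LSeries a (c + d) - y⁻¹ * LSeries a (c + d + 1) with hE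
  have hcpow {s : ℂ} {r : ℝ} (hs : s.re ≤ r) : ‖(y : ℂ) ^ s‖ ≤ y ^ r := by
    rw [norm_cpow_eq_rpow_re_of_pos hy0]
    exact Real.rpow_le_rpow_of_exponent_le hy hs
  have hdiff {s : ℂ} (hs : 0 < s.re) :
      DifferentiableAt ℂ (fun s => (y : ℂ) ^ s * cesaroKernel s) s :=
    (differentiableAt_id.const_cpow (Or.inl hyC)).mul (differentiableAt_cesaroKernel hs)
  have hbound {s : ℂ} {b r : ℝ} (hb : 0 < b) (hb1 : b ≤ 1) (hs : b ≤ s.re) (hr : s.re ≤ r) :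
      ‖(y : ℂ) ^ s * cesaroKernel s‖ ≤ y ^ r * b⁻¹ ^ 2 / (1 + s.im ^ 2) := by
    rw [norm_mul, mul_div_assoc]
    exact mul_le_mul (hcpow hr) (norm_cesaroKernel_le hb hb1 hs) (norm_nonneg _) (by positivity)
  obtain ⟨hintD, heqD⟩ := h.integrable_and_integral_eq (c := c) (k := fun s =>
      (y : ℂ) ^ s * cesaroKernel s) (B := y ^ c * (1 / 2 : ℝ)⁻¹ ^ 2) hσ (by linarith) (by linarith)
    (fun s hs => (hdiff (by linarith [hs.1])).differentiableWithinAt)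
    (fun s hs => hbound (by norm_num) (by norm_num) (by linarith [hs.1]) hs.2)
  obtain ⟨hintE, heqE⟩ := h.integrable_and_integral_eq (c := c) (k := fun s =>
      (y : ℂ) ^ (2 * σ - s) * cesaroKernel (2 * σ - s)) (B := y ^ σ * d⁻¹ ^ 2)
    hσ (by linarith) (by linarith)
    (fun s hs => by
      refine DifferentiableAt.differentiableWithinAt ?_
      exact DifferentiableAt.comp s (g := fun s => (y : ℂ) ^ s * cesaroKernel s)
        (f := fun s : ℂ => 2 * σ - s) (hdiff (by simp; linarith [hs.2])) (by fun_prop))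
    (fun s hs => by
      have := hbound (s := 2 * σ - s) (r := σ) hd0 (by linarith) (by simp; linarith [hs.2])
        (by simp; linarith [hs.1])
      simpa using this)
  have hD : ∫ t : ℝ, F (σ + t * I) * ((y : ℂ) ^ (σ + t * I : ℂ) * cesaroKernel (σ + t * I)) =
      2 * Real.pi * T := by
    rw [heqD, hT, ← integral_LSeries_mul_cesaroKernel h.norm_coeff_le (c := c) (by linarith) hy0]
    refine integral_congr_ae (Eventually.of_forall fun t => ?_)
    simp only
    rw [h.eq_LSeries _ (by simp; linarith)]
  have hE' : ∫ t : ℝ, F (σ + t * I) * ((y : ℂ) ^ (2 * σ - (σ + t * I) : ℂ) *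
      cesaroKernel (2 * σ - (σ + t * I))) = 2 * Real.pi * E := by
    rw [heqE, hE, ← integral_LSeries_mul_cesaroKernel_reflected h.norm_coeff_le (c := c)
      (by linarith) hd0 hy]
    refine integral_congr_ae (Eventually.of_forall fun t => ?_)
    have e : (2 * σ - (c + t * I) : ℂ) = d - t * I := by
      rw [hc, hd]; push_cast; ring
    simp only [e]
    rw [h.eq_LSeries _ (by simp; linarith)]
  have hconj (t : ℝ) : (y : ℂ) ^ (2 * σ - (σ + t * I) : ℂ) * cesaroKernel (2 * σ - (σ + t * I)) =
      (starRingEnd ℂ) ((y : ℂ) ^ (σ + t * I : ℂ) * cesaroKernel (σ + t * I)) := by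
    have e : (2 * σ - (σ + t * I) : ℂ) = (starRingEnd ℂ) (σ + t * I) := by
      simp; ring
    rw [e, map_mul, cpow_conj _ _ (by rw [arg_ofReal_of_nonneg hy0.le]; exact Real.pi_pos.ne),
      conj_ofReal]
    simp [cesaroKernel]
  simp only [hconj] at hE' hintE
  have hE'' : ∫ t : ℝ, (starRingEnd ℂ) (F (σ + t * I)) *
      ((y : ℂ) ^ (σ + t * I : ℂ) * cesaroKernel (σ + t * I)) =
      2 * Real.pi * (starRingEnd ℂ) E := by
    have := congrArg (starRingEnd ℂ) hE'
    rw [← integral_conj] at this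
    simpa [conj_ofNat] using this
  have hintE' : Integrable fun t : ℝ => (starRingEnd ℂ) (F (σ + t * I)) *
      ((y : ℂ) ^ (σ + t * I : ℂ) * cesaroKernel (σ + t * I)) := by
    have := (conjCLE : ℂ ≃L[ℝ] ℂ).toContinuousLinearMap.integrable_comp hintE
    simpa using this
  obtain ⟨hinteg, hle⟩ := h.integrable_re_and_integral_abs_re_le hσ (by linarith)
  have hsum : ‖(2 * Real.pi * T + 2 * Real.pi * (starRingEnd ℂ) E : ℂ)‖ ≤
      72 * y ^ σ * (2 * A * Real.pi + 36 * tailIntegral + 2 * Real.pi) := by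
    rw [← hD, ← hE'', ← integral_add hintD hintE']
    refine (norm_integral_le_of_norm_le (hinteg.const_mul (72 * y ^ σ))
      (Eventually.of_forall fun t => ?_)).trans ?_
    · rw [← add_mul, add_conj, norm_mul, norm_real, Real.norm_eq_abs, abs_mul, abs_two]
      have hb := hbound (s := σ + t * I) (b := 1 / 2) (r := σ) (by norm_num) (by norm_num)
        (by simpa using by linarith) (by simp)
      simp at hb
      have h1 : y ^ σ * 2 ^ 2 / (1 + t ^ 2) ≤ 36 * y ^ σ / (9 + t ^ 2) := by
        rw [div_le_div_iff₀ (by positivity) (by positivity)]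
        have : 0 < y ^ σ := by positivity
        nlinarith [mul_nonneg this.le (sq_nonneg t)]
      calc _ ≤ 2 * |(F (σ + t * I)).re| * (36 * y ^ σ / (9 + t ^ 2)) := by
            refine mul_le_mul_of_nonneg_left ?_ (by positivity)
            rw [norm_mul]
            exact hb.trans h1
        _ = _ := by ring
    · rw [integral_const_mul]
      exact mul_le_mul_of_nonneg_left hle (by positivity)
  have hEn : ‖E‖ ≤ 6 * A + 26 := by
    have h1 : ‖LSeries a (c + d)‖ ≤ 6 * A + 24 := by
      rw [← h.eq_LSeries _ (by simp; linarith)]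
      refine (h.norm_le (by simp; linarith) (by simp; linarith)).trans ?_
      have hl : Real.log 6 ≤ 2 := by
        rw [Real.log_le_iff_le_exp (by norm_num)]
        have := Real.exp_one_gt_d9
        rw [show (2 : ℝ) = 1 + 1 by norm_num, Real.exp_add]
        nlinarith
      rw [div_le_iff₀ (by simp; linarith)]
      simp
      nlinarith
    have h2 : ‖(y⁻¹ : ℝ) * LSeries a (c + d + 1)‖ ≤ 2 := by
      rw [norm_mul, norm_real, Real.norm_eq_abs, abs_of_pos (inv_pos.2 hy0)]
      have h3 := norm_LSeries_le_two h.norm_coeff_le (s := c + d + 1) (by simp; linarith)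
      nlinarith [inv_le_one_of_one_le₀ hy, inv_pos.2 hy0, norm_nonneg (LSeries a (c + d + 1))]
    refine (norm_sub_le _ _).trans ?_
    linarith
  have hpi := Real.pi_pos
  have hyσ : 1 ≤ y ^ σ := Real.one_le_rpow hy (by linarith)
  have h2 : ‖T + (starRingEnd ℂ) E‖ ≤ 72 * y ^ σ * (A + 18 * tailIntegral + 1) := by
    rw [← mul_add, norm_mul] at hsum
    have : ‖(2 * Real.pi : ℂ)‖ = 2 * Real.pi := by
      simp [abs_of_pos hpi]
    rw [this] at hsum
    have hJ := tailIntegral_nonneg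
    have h3 : 36 * tailIntegral ≤ 36 * tailIntegral * Real.pi := by
      nlinarith [Real.pi_gt_three]
    have h4 : 72 * y ^ σ * (2 * A * Real.pi + 36 * tailIntegral + 2 * Real.pi) ≤
        2 * Real.pi * (72 * y ^ σ * (A + 18 * tailIntegral + 1)) := by
      have : 72 * y ^ σ * (2 * A * Real.pi + 36 * tailIntegral + 2 * Real.pi) ≤
        72 * y ^ σ * (2 * A * Real.pi + 36 * tailIntegral * Real.pi + 2 * Real.pi) := by gcongr
      linarith
    exact le_of_mul_le_mul_left (hsum.trans h4) (by positivity)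
  have h5 : ‖T‖ ≤ ‖T + (starRingEnd ℂ) E‖ + ‖E‖ := by
    have := norm_sub_le (T + (starRingEnd ℂ) E) ((starRingEnd ℂ) E)
    simpa using this
  nlinarith

theorem norm_sum_le (h : IsLogOfLSeries a F A) {y : ℝ} (hy : 1 ≤ y) :
    ‖∑ n ∈ Finset.Icc 1 ⌊y⌋₊, a n * (1 - n / y)‖ ≤
      (72 * (A + 18 * tailIntegral + 1) + (6 * A + 26)) * √y := by
  have hcont : ContinuousAt (fun σ : ℝ =>
      (72 * (A + 18 * tailIntegral + 1) + (6 * A + 26)) * y ^ σ) (1 / 2) :=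
    continuousAt_const.mul (Real.continuousAt_const_rpow (by linarith))
  rw [Real.sqrt_eq_rpow]
  refine ge_of_tendsto (hcont.tendsto.mono_left (nhdsWithin_le_nhds (s := Ioi (1 / 2)))) ?_
  filter_upwards [Ioc_mem_nhdsGT (by norm_num : (1 / 2 : ℝ) < 3 / 4)] with σ hσ
  exact h.norm_sum_le_rpow hσ.1 hσ.2 hy

end IsLogOfLSeries

theorem isOpen_half_lt_re : IsOpen {s : ℂ | 1 / 2 < s.re} := isOpen_lt continuous_const continuous_re

theorem isPreconnected_half_lt_re : IsPreconnected {s : ℂ | 1 / 2 < s.re} :=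
  (convex_halfSpace_re_gt _).isPreconnected

/-- A holomorphic function on the half plane `re s > 1 / 2` has a primitive. -/
theorem isExactOn_half_lt_re {f : ℂ → ℂ} (hf : DifferentiableOn ℂ f {s | 1 / 2 < s.re}) :
    IsExactOn f {s | 1 / 2 < s.re} := by
  have hne {z : ℂ} (hz : z ∈ Metric.ball (0 : ℂ) 1) : 1 - z ≠ 0 := by
    rintro h
    rw [sub_eq_zero] at h
    simp [← h] at hz
  have hmaps {z : ℂ} (hz : z ∈ Metric.ball (0 : ℂ) 1) :
      1 / 2 < ((1 / 2 : ℝ) + (1 + z) / (1 - z) : ℂ).re := by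
    have h1 : 0 < normSq (1 - z) := normSq_pos.2 (hne hz)
    have h2 : normSq z < 1 := by
      rw [normSq_eq_norm_sq]
      have : ‖z‖ < 1 := by simpa using hz
      nlinarith [norm_nonneg z]
    rw [normSq_apply] at h2
    have h3 : 0 < ((1 + z) / (1 - z)).re := by
      rw [div_re, ← add_div]
      refine div_pos ?_ h1
      simp
      nlinarith
    rw [add_re, ofReal_re]
    linarith
  obtain ⟨G, hG⟩ := DifferentiableOn.isExactOn_ball (c := 0) (r := 1)
    (f := fun z => f ((1 / 2 : ℝ) + (1 + z) / (1 - z)) * (2 / (1 - z) ^ 2)) (by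
      intro z hz
      refine DifferentiableAt.differentiableWithinAt ?_
      refine DifferentiableAt.mul ?_ ?_
      · refine DifferentiableAt.comp z
          (hf.differentiableAt (isOpen_half_lt_re.mem_nhds (hmaps hz))) ?_
        exact (differentiableAt_const _).add
          (((differentiableAt_const _).add differentiableAt_id).div
            ((differentiableAt_const _).sub differentiableAt_id) (hne hz))
      · exact (differentiableAt_const _).div
          (((differentiableAt_const _).sub differentiableAt_id).pow 2) (pow_ne_zero _ (hne hz)))
  refine ⟨fun s => G ((s - (1 / 2 : ℝ) - 1) / (s - (1 / 2 : ℝ) + 1)), fun s hs => ?_⟩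
  have hw : 0 < (s - (1 / 2 : ℝ)).re := by
    have : 1 / 2 < s.re := hs
    simp only [sub_re, ofReal_re]
    linarith
  set w := s - (1 / 2 : ℝ) with hwdef
  have hw1 : w + 1 ≠ 0 := by
    intro h
    have := congrArg re h
    simp at this
    linarith
  have hball : (w - 1) / (w + 1) ∈ Metric.ball (0 : ℂ) 1 := by
    rw [mem_ball_zero_iff, norm_div, div_lt_one (norm_pos_iff.2 hw1)]
    refine lt_of_pow_lt_pow_left₀ 2 (norm_nonneg _) ?_
    rw [Complex.sq_norm, Complex.sq_norm, normSq_apply, normSq_apply]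
    simp
    nlinarith
  have hψ : HasDerivAt (fun s : ℂ => (s - (1 / 2 : ℝ) - 1) / (s - (1 / 2 : ℝ) + 1))
      (2 / (w + 1) ^ 2) s := by
    have h := (((hasDerivAt_id s).sub_const ((1 / 2 : ℝ) : ℂ)).sub_const 1).div
      (((hasDerivAt_id s).sub_const ((1 / 2 : ℝ) : ℂ)).add_const 1) hw1
    convert! h using 1
    simp only [id, ← hwdef]
    congr 1
    ring
  have h := (hG _ hball).comp s hψ
  convert! h using 1
  have e1 : 1 - (w - 1) / (w + 1) = 2 / (w + 1) := by field_simp; ring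
  have e2 : ((1 / 2 : ℝ) : ℂ) + (1 + (w - 1) / (w + 1)) / (1 - (w - 1) / (w + 1)) = s := by
    rw [e1]
    have : (1 + (w - 1) / (w + 1)) / (2 / (w + 1)) = w := by field_simp; ring
    rw [this, hwdef]
    ring
  beta_reduce
  rw [e2, e1]
  field_simp

theorem abscissaOfAbsConv_lt_of_norm_le_one {a : ℕ → ℂ} (ha : ∀ n, ‖a n‖ ≤ 1) {s : ℂ}
    (hs : 1 < s.re) : LSeries.abscissaOfAbsConv a < s.re :=
  (LSeries.abscissaOfAbsConv_le_of_forall_lt_LSeriesSummable (x := 1) fun y hy =>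
    LSeriesSummable_of_norm_le_one ha (by simpa using hy)).trans_lt (by exact_mod_cast hs)

namespace DirichletCharacter

variable {M : ℕ} {χ : DirichletCharacter ℂ M}

/-- The coefficients of the Dirichlet series of `log L(s, χ)`. -/
noncomputable def logCoeff (χ : DirichletCharacter ℂ M) (n : ℕ) : ℂ :=
  χ n * (ArithmeticFunction.vonMangoldt n / Real.log n : ℝ)

theorem norm_logCoeff_le_one (χ : DirichletCharacter ℂ M) (n : ℕ) : ‖logCoeff χ n‖ ≤ 1 := by
  rw [logCoeff, norm_mul, norm_real, Real.norm_eq_abs]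
  refine mul_le_one₀ (χ.norm_le_one n) (abs_nonneg _) ?_
  have h0 : 0 ≤ Real.log n := Real.log_natCast_nonneg n
  rw [abs_of_nonneg (div_nonneg ArithmeticFunction.vonMangoldt_nonneg h0)]
  exact div_le_one_of_le₀ ArithmeticFunction.vonMangoldt_le_log h0

theorem logMul_logCoeff (χ : DirichletCharacter ℂ M) (n : ℕ) :
    LSeries.logMul (logCoeff χ) n = χ n * (ArithmeticFunction.vonMangoldt n : ℂ) := by
  rw [LSeries.logMul, logCoeff, ← natCast_log]
  rcases eq_or_ne (Real.log n) 0 with h | h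
  · have : ArithmeticFunction.vonMangoldt n = 0 :=
      le_antisymm (ArithmeticFunction.vonMangoldt_le_log.trans h.le)
        ArithmeticFunction.vonMangoldt_nonneg
    simp [h, this]
  · have : (Real.log n : ℂ) ≠ 0 := by exact_mod_cast h
    rw [ofReal_div]
    field_simp

variable [NeZero M]

theorem sum_range_eq_zero (hχ : χ ≠ 1) : ∑ k ∈ Finset.range M, χ k = 0 := by
  rw [← MulChar.sum_eq_zero_of_ne_one hχ]
  refine Finset.sum_bij' (fun k _ => (k : ZMod M)) (fun a _ => a.val) (by simp)
    (fun a _ => by simpa using a.val_lt) (fun k hk => ?_) (by simp) (by simp)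
  exact ZMod.val_cast_of_lt (Finset.mem_range.1 hk)

theorem norm_sum_range_le (hχ : χ ≠ 1) (n : ℕ) : ‖∑ k ∈ Finset.range n, χ k‖ ≤ M := by
  induction n using Nat.strong_induction_on with
  | _ n ih =>
    rcases lt_or_ge n M with h | h
    · refine (norm_sum_le _ _).trans ((Finset.sum_le_card_nsmul _ _ 1 fun (k : ℕ) _ =>
        χ.norm_le_one k).trans ?_)
      simpa using h.le
    · have e : ∑ k ∈ Finset.range n, χ k = ∑ k ∈ Finset.range (n - M), χ k := by
        conv_lhs => rw [← Nat.add_sub_cancel' h, Finset.sum_range_add, sum_range_eq_zero hχ]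
        simp
      rw [e]
      exact ih _ (Nat.sub_lt_of_pos_le (Nat.pos_of_neZero M) h)

theorem norm_sum_Icc_le (hχ : χ ≠ 1) (n : ℕ) : ‖∑ k ∈ Finset.Icc 1 n, χ k‖ ≤ M := by
  have : χ (0 : ZMod M) = 0 := by
    have : M ≠ 1 := by
      rintro rfl
      exact hχ (Subsingleton.elim _ _)
    have : Nontrivial (ZMod M) := ZMod.nontrivial_iff.2 this
    exact χ.map_nonunit not_isUnit_zero
  have e : ∑ k ∈ Finset.Icc 1 n, χ k = ∑ k ∈ Finset.range (n + 1), χ k := by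
    rw [Finset.range_eq_Ico, Finset.sum_eq_sum_Ico_succ_bot (Nat.succ_pos n), Nat.cast_zero, this,
      zero_add]
    rfl
  rw [e]
  exact norm_sum_range_le hχ _

theorem norm_LFunction_le (hχ : χ ≠ 1) {s : ℂ} (hs : 1 / 2 < s.re) :
    ‖LFunction χ s‖ ≤ 2 * M * ‖s‖ := by
  set S : ℝ → ℂ := fun t => ∑ k ∈ Finset.Icc 1 ⌊t⌋₊, χ k with hS
  have hSn (t : ℝ) : ‖S t‖ ≤ M := norm_sum_Icc_le hχ _
  have hS0 {t : ℝ} (ht : t < 1) : S t = 0 := by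
    simp [hS, Nat.floor_eq_zero.2 ht]
  have hmeas : Measurable S :=
    (measurable_from_nat (f := fun n => ∑ k ∈ Finset.Icc 1 n, χ k)).comp Nat.measurable_floor
  have hloc : LocallyIntegrableOn S (Ioi 0) := by
    refine LocallyIntegrable.locallyIntegrableOn ?_ _
    exact (locallyIntegrable_const (M : ℝ)).mono hmeas.aestronglyMeasurable
      (Eventually.of_forall fun t => by simpa using hSn t)
  have hmellin (s : ℂ) : mellin S (-s) = ∫ t in Ioi (1 : ℝ), S t * (t : ℂ) ^ (-(s + 1)) := by
    rw [mellin, setIntegral_eq_of_subset_of_forall_sdiff_eq_zero (s := Ici (1 : ℝ))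
      (t := Ioi 0) measurableSet_Ioi (fun t ht => lt_of_lt_of_le zero_lt_one (mem_Ici.1 ht))
      (fun t ht => by rw [hS0 (by simpa using ht.2), smul_zero]), integral_Ici_eq_integral_Ioi]
    refine setIntegral_congr_fun measurableSet_Ioi fun t _ => ?_
    simp only [smul_eq_mul]
    rw [mul_comm, neg_add']
  have hdiff : DifferentiableOn ℂ (fun s => s * mellin S (-s)) {s | 1 / 2 < s.re} := by
    intro s hs
    have hs' : 1 / 2 < s.re := hs
    refine DifferentiableAt.differentiableWithinAt (differentiableAt_id.mul ?_)
    refine DifferentiableAt.comp s (g := mellin S) ?_ differentiableAt_id.neg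
    refine mellin_differentiableAt_of_isBigO_rpow (a := 0) (b := -s.re - 1) hloc ?_
      (by simp; linarith) ?_ (by simp)
    · simp only [neg_zero, Real.rpow_zero]
      exact Asymptotics.isBigO_of_le' _ (c := M) fun t => by simpa using hSn t
    · refine Asymptotics.IsBigO.of_bound 1 ?_
      filter_upwards [Ioo_mem_nhdsGT zero_lt_one] with t ht
      rw [hS0 ht.2]
      simp
  have hO : (fun n : ℕ => ∑ k ∈ Finset.Icc 1 n, χ k) =O[atTop] fun n : ℕ => (n : ℝ) ^ (0 : ℝ) :=
    Asymptotics.isBigO_of_le' _ (c := M) fun n => by simpa using norm_sum_Icc_le hχ n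
  have heq : EqOn (LFunction χ) (fun s => s * mellin S (-s)) {s | 1 / 2 < s.re} := by
    refine AnalyticOnNhd.eqOn_of_preconnected_of_eventuallyEq (z₀ := 2)
      ((differentiable_LFunction hχ).differentiableOn.analyticOnNhd isOpen_half_lt_re)
      (hdiff.analyticOnNhd isOpen_half_lt_re) isPreconnected_half_lt_re (by norm_num) ?_
    filter_upwards [(isOpen_lt continuous_const continuous_re).mem_nhds
      (show (2 : ℂ) ∈ {s : ℂ | 1 < s.re} by norm_num)] with s hs
    have hs' : 1 < s.re := hs
    rw [LFunction_eq_LSeries χ hs', hmellin]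
    exact LSeries_eq_mul_integral _ le_rfl (by linarith)
      (LSeriesSummable_of_norm_le_one (fun n => χ.norm_le_one n) hs') hO
  rw [heq hs, norm_mul, mul_comm, hmellin]
  refine mul_le_mul_of_nonneg_right ?_ (norm_nonneg _)
  have hlt : -s.re - 1 < -1 := by linarith
  calc _ ≤ ∫ t in Ioi (1 : ℝ), M * t ^ (-s.re - 1) := by
        refine norm_integral_le_of_norm_le
          ((integrableOn_Ioi_rpow_of_lt hlt zero_lt_one).const_mul _) ?_
        filter_upwards [ae_restrict_mem measurableSet_Ioi] with t ht
        have ht' : 0 < t := zero_lt_one.trans ht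
        rw [norm_mul, norm_cpow_eq_rpow_re_of_pos ht']
        refine mul_le_mul (hSn t) (le_of_eq ?_) (by positivity) (by positivity)
        congr 1
        simp
        ring
    _ = M / s.re := by
        rw [integral_const_mul, integral_Ioi_rpow_of_lt hlt zero_lt_one, Real.one_rpow]
        have : s.re ≠ 0 := by linarith
        rw [show -s.re - 1 + 1 = -s.re by ring, neg_div_neg_eq, mul_one_div]
    _ ≤ 2 * M := by
        rw [div_le_iff₀ (by linarith)]
        nlinarith [Nat.cast_nonneg (α := ℝ) M]

theorem hasDerivAt_LSeries_logCoeff (χ : DirichletCharacter ℂ M) {s : ℂ} (hs : 1 < s.re) :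
    HasDerivAt (LSeries (logCoeff χ)) (deriv (LFunction χ) s / LFunction χ s) s := by
  have h := LSeries_hasDerivAt (abscissaOfAbsConv_lt_of_norm_le_one (norm_logCoeff_le_one χ) hs)
  convert! h using 1
  have h1 := LSeries_twist_vonMangoldt_eq χ hs
  rw [deriv_LFunction_eq_deriv_LSeries χ hs, LFunction_eq_LSeries χ hs]
  have h2 : LSeries (LSeries.logMul (logCoeff χ)) s =
      LSeries ((fun n : ℕ => χ n) * fun n : ℕ => (ArithmeticFunction.vonMangoldt n : ℂ)) s :=
    LSeries_congr (fun {n} _ => by simp [logMul_logCoeff]) s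
  rw [h2, h1, neg_div, neg_neg]

theorem exists_isLogOfLSeries (hχ : χ ≠ 1) (h0 : ∀ s : ℂ, 1 / 2 < s.re → LFunction χ s ≠ 0) :
    ∃ F, IsLogOfLSeries (logCoeff χ) F (Real.log (2 * M)) := by
  have hL := differentiable_LFunction hχ
  have hM : (1 : ℝ) ≤ M := by exact_mod_cast Nat.pos_of_neZero M
  obtain ⟨F₀, hF₀⟩ := isExactOn_half_lt_re (f := fun s => deriv (LFunction χ) s / LFunction χ s)
    (hL.deriv.differentiableOn.div hL.differentiableOn h0)
  have hopen : IsOpen {s : ℂ | 1 < s.re} := isOpen_lt continuous_const continuous_re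
  have hsub {s : ℂ} (hs : 1 < s.re) : 1 / 2 < s.re := by linarith
  obtain ⟨c, hc⟩ := hopen.exists_eq_add_of_deriv_eq (convex_halfSpace_re_gt 1).isPreconnected
    (f := LSeries (logCoeff χ)) (g := F₀)
    (fun s hs => (hasDerivAt_LSeries_logCoeff χ hs).differentiableAt.differentiableWithinAt)
    (fun s hs => (hF₀ s (hsub hs)).differentiableAt.differentiableWithinAt)
    (fun s hs => by rw [(hasDerivAt_LSeries_logCoeff χ hs).deriv, (hF₀ s (hsub hs)).deriv])
  have hF (s : ℂ) (hs : 1 / 2 < s.re) :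
      HasDerivAt (fun s => F₀ s + c) (deriv (LFunction χ) s / LFunction χ s) s :=
    (hF₀ s hs).add_const c
  have hquot (s : ℂ) (hs : 1 / 2 < s.re) :
      HasDerivAt (fun s => exp (F₀ s + c) / LFunction χ s) 0 s := by
    have h := (hF s hs).cexp.div (hL s).hasDerivAt (h0 s hs)
    convert! h using 1
    have := h0 s hs
    field_simp
    ring
  obtain ⟨b, hb⟩ := isOpen_half_lt_re.exists_is_const_of_deriv_eq_zero isPreconnected_half_lt_re
    (fun s hs => (hquot s hs).differentiableAt.differentiableWithinAt)
    (fun s hs => (hquot s hs).deriv)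
  have hab {a : ℕ → ℂ} (ha : ∀ n, ‖a n‖ ≤ 1) : LSeries.abscissaOfAbsConv a < ⊤ :=
    (abscissaOfAbsConv_lt_of_norm_le_one ha (s := 2) (by norm_num)).trans (EReal.coe_lt_top _)
  have hb1 : b = 1 := by
    have h1 := (LSeries.tendsto_atTop (hab (norm_logCoeff_le_one χ))).cexp
    have h2 := LSeries.tendsto_atTop (hab (a := fun n => χ n) fun n => χ.norm_le_one n)
    have h3 := h1.div h2 (by simp)
    refine tendsto_nhds_unique (tendsto_const_nhds.congr' ?_)
      (by simpa [logCoeff] using h3)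
    filter_upwards [eventually_gt_atTop 1] with t ht
    have ht' : 1 < (t : ℂ).re := by simpa using ht
    rw [← hb t (hsub ht'), show F₀ t + c = _ from (hc ht').symm, LFunction_eq_LSeries χ ht']
    rfl
  have hexp (s : ℂ) (hs : 1 / 2 < s.re) : exp (F₀ s + c) = LFunction χ s := by
    rw [← one_mul (LFunction χ s), ← hb1, ← hb s hs, div_mul_cancel₀ _ (h0 s hs)]
  refine ⟨fun s => F₀ s + c, norm_logCoeff_le_one χ,
    fun s hs => (hF s hs).differentiableAt.differentiableWithinAt, fun s hs => (hc hs).symm,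
    Real.log_nonneg (by linarith), fun s hs => ?_⟩
  have h1 := norm_LFunction_le hχ hs
  rw [← hexp s hs, norm_exp] at h1
  have hs' : 0 < ‖s‖ := by
    rw [norm_pos_iff]; rintro rfl; norm_num at hs
  rw [← Real.log_mul (by positivity) (by positivity), Real.le_log_iff_exp_le (by positivity)]
  refine h1.trans ?_
  gcongr
  linarith

theorem norm_sum_logCoeff_le (hχ : χ ≠ 1) (h0 : ∀ s : ℂ, 1 / 2 < s.re → LFunction χ s ≠ 0)
    {y : ℝ} (hy : 1 ≤ y) :
    ‖∑ n ∈ Finset.Icc 1 ⌊y⌋₊, logCoeff χ n * (1 - n / y)‖ ≤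
      (78 * Real.log (2 * M) + (1296 * tailIntegral + 98)) * √y := by
  obtain ⟨F, hF⟩ := exists_isLogOfLSeries hχ h0
  refine (hF.norm_sum_le hy).trans (le_of_eq ?_)
  ring

end DirichletCharacter

namespace DirichletCharacter

variable {M : ℕ} {Q : Type*} [CommGroup Q]

/-- The Dirichlet character attached to a character of a quotient `Q` of `(ZMod M)ˣ`. -/
noncomputable def ofQuotient (π : (ZMod M)ˣ →* Q) (ψ : AddChar (Additive Q) ℂ) :
    DirichletCharacter ℂ M :=
  MulChar.ofUnitHom ((MonoidHom.toHomUnits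
    { toFun := fun q => ψ (Additive.ofMul q)
      map_one' := ψ.map_zero_eq_one
      map_mul' := fun a b => ψ.map_add_eq_mul (Additive.ofMul a) (Additive.ofMul b) }).comp π)

theorem ofQuotient_apply_coe (π : (ZMod M)ˣ →* Q) (ψ : AddChar (Additive Q) ℂ) (u : (ZMod M)ˣ) :
    ofQuotient π ψ u = ψ (Additive.ofMul (π u)) := by
  rw [ofQuotient, MulChar.ofUnitHom_coe]
  rfl

theorem ofQuotient_ne_one {π : (ZMod M)ˣ →* Q} (hπ : Function.Surjective π)
    {ψ : AddChar (Additive Q) ℂ} (hψ : ψ ≠ 0) : ofQuotient π ψ ≠ 1 := by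
  intro h
  refine hψ (DFunLike.ext _ _ fun a => ?_)
  obtain ⟨u, hu⟩ := hπ a.toMul
  have := ofQuotient_apply_coe π ψ u
  rw [h, MulChar.one_apply_coe, hu] at this
  simpa using this.symm

open Classical in
theorem sum_ofQuotient_apply [Fintype Q] (π : (ZMod M)ˣ →* Q) (a : ZMod M) :
    ∑ ψ : AddChar (Additive Q) ℂ, ofQuotient π ψ a =
      if ∃ u, π u = 1 ∧ (u : ZMod M) = a then (Fintype.card Q : ℂ) else 0 := by
  by_cases ha : IsUnit a
  · obtain ⟨u, rfl⟩ := ha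
    simp only [ofQuotient_apply_coe]
    rw [AddChar.sum_apply_eq_ite]
    have : (∃ v, π v = 1 ∧ (v : ZMod M) = u) ↔ Additive.ofMul (π u) = 0 := by
      rw [ofMul_eq_zero]
      simp [Units.val_inj]
    rw [if_congr this.symm rfl rfl, Fintype.card_additive]
  · rw [if_neg (by rintro ⟨u, -, rfl⟩; exact ha u.isUnit)]
    exact Finset.sum_eq_zero fun ψ _ => MulChar.map_nonunit _ ha

open Classical in
theorem sum_isUnit_le_card_mul [NeZero M] [Fintype Q]
    (h0 : ∀ χ : DirichletCharacter ℂ M, χ ≠ 1 → ∀ s : ℂ, 1 / 2 < s.re → LFunction χ s ≠ 0)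
    {π : (ZMod M)ˣ →* Q} (hπ : Function.Surjective π) {y : ℝ} (hy : 1 ≤ y) :
    ∑ n ∈ Finset.Icc 1 ⌊y⌋₊, (if IsUnit (n : ZMod M) then
        ArithmeticFunction.vonMangoldt n / Real.log n * (1 - n / y) else 0) ≤
      Fintype.card Q * (∑ n ∈ Finset.Icc 1 ⌊y⌋₊, (if ∃ u, π u = 1 ∧ (u : ZMod M) = n then
        ArithmeticFunction.vonMangoldt n / Real.log n * (1 - n / y) else 0) +
      (78 * Real.log (2 * M) + (1296 * tailIntegral + 98)) * √y) := by
  set B := (78 * Real.log (2 * M) + (1296 * tailIntegral + 98)) * √y with hB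
  set S₁ := ∑ n ∈ Finset.Icc 1 ⌊y⌋₊, (if IsUnit (n : ZMod M) then
        ArithmeticFunction.vonMangoldt n / Real.log n * (1 - n / y) else 0)
  set S := ∑ n ∈ Finset.Icc 1 ⌊y⌋₊, (if ∃ u, π u = 1 ∧ (u : ZMod M) = n then
        ArithmeticFunction.vonMangoldt n / Real.log n * (1 - n / y) else 0)
  let T (ψ : AddChar (Additive Q) ℂ) : ℂ :=
    ∑ n ∈ Finset.Icc 1 ⌊y⌋₊, logCoeff (ofQuotient π ψ) n * (1 - n / y)
  have hT0 : T 0 = S₁ := by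
    simp only [T, S₁, ofReal_sum]
    refine Finset.sum_congr rfl fun n _ => ?_
    rw [logCoeff]
    split_ifs with h
    · obtain ⟨u, hu⟩ := h
      rw [← hu, ofQuotient_apply_coe]
      simp
    · rw [MulChar.map_nonunit _ h]
      simp
  have hTsum : ∑ ψ, T ψ = Fintype.card Q * S := by
    simp only [T, S]
    rw [Finset.sum_comm, ofReal_sum, Finset.mul_sum]
    refine Finset.sum_congr rfl fun n _ => ?_
    simp only [logCoeff]
    rw [← Finset.sum_mul, ← Finset.sum_mul, sum_ofQuotient_apply]
    split_ifs with h <;> push_cast <;> ring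
  have hM : (1 : ℝ) ≤ M := by exact_mod_cast Nat.pos_of_neZero M
  have hB0 : 0 ≤ B := by
    have := Real.log_nonneg (by linarith : (1 : ℝ) ≤ 2 * M)
    have := tailIntegral_nonneg
    positivity
  have hcard : (Fintype.card (AddChar (Additive Q) ℂ) : ℝ) = Fintype.card Q := by
    rw [AddChar.card_eq, Fintype.card_additive]
  have hrest : ‖∑ ψ ∈ Finset.univ.erase 0, T ψ‖ ≤ Fintype.card Q * B := by
    refine (norm_sum_le_of_le _ fun ψ hψ => norm_sum_logCoeff_le
      (ofQuotient_ne_one hπ (Finset.ne_of_mem_erase hψ))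
      (h0 _ (ofQuotient_ne_one hπ (Finset.ne_of_mem_erase hψ))) hy).trans ?_
    rw [Finset.sum_const, nsmul_eq_mul, ← hcard]
    refine mul_le_mul_of_nonneg_right ?_ hB0
    exact_mod_cast Finset.card_le_univ _
  rw [← Finset.add_sum_erase _ _ (Finset.mem_univ 0), hT0] at hTsum
  have e : (∑ ψ ∈ Finset.univ.erase 0, T ψ) = ((Fintype.card Q * S - S₁ : ℝ) : ℂ) := by
    push_cast
    linear_combination hTsum
  rw [e, norm_real, Real.norm_eq_abs] at hrest
  linarith [neg_le_of_abs_le hrest]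

end DirichletCharacter

theorem div_log_le_primeCounting {y : ℝ} (hy : 20 ≤ y) :
    y / (10 * Real.log y) ≤ Nat.primeCounting ⌊y / 2⌋₊ := by
  have h := Chebyshev.pi_ge' (x := y / 2) (by linarith)
  refine le_trans ?_ h
  have hl2 := Real.log_two_gt_d9
  have hl2' := Real.log_two_lt_d9
  have h1 : Real.log (y / 2 + 2) ≤ y / 32 + 2 := by
    have e : y / 2 + 2 = (y / 32 + 1 / 8) * 2 ^ 4 := by ring
    rw [e, Real.log_mul (by linarith) (by norm_num), Real.log_pow]
    have := Real.log_le_sub_one_of_pos (by linarith : 0 < y / 32 + 1 / 8)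
    push_cast
    linarith
  have h2 : 0 < Real.log (y / 2) := Real.log_pos (by linarith)
  have h3 : Real.log (y / 2) ≤ Real.log y := Real.log_le_log (by linarith) (by linarith)
  rw [← div_div]
  refine div_le_div₀ ?_ ?_ h2 h3
  · nlinarith
  · nlinarith

open Classical in
theorem le_sum_isUnit_vonMangoldt {M : ℕ} [NeZero M] {y : ℝ} (hy : 0 < y) :
    ((Nat.primeCounting ⌊y / 2⌋₊ : ℝ) - M.primeFactors.card) / 2 ≤
      ∑ n ∈ Finset.Icc 1 ⌊y⌋₊, (if IsUnit (n : ZMod M) then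
        ArithmeticFunction.vonMangoldt n / Real.log n * (1 - n / y) else 0) := by
  have hsub : Nat.primesLE ⌊y / 2⌋₊ \ M.primeFactors ⊆ Finset.Icc 1 ⌊y⌋₊ := by
    intro p hp
    simp only [Finset.mem_sdiff, Nat.mem_primesLE] at hp
    exact Finset.mem_Icc.2 ⟨hp.1.2.one_le, hp.1.1.trans (Nat.floor_mono (by linarith))⟩
  refine le_trans ?_ (Finset.sum_le_sum_of_subset_of_nonneg hsub fun n hn _ => ?_)
  · have h1 : ((Nat.primeCounting ⌊y / 2⌋₊ : ℝ) - M.primeFactors.card) ≤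
        (Nat.primesLE ⌊y / 2⌋₊ \ M.primeFactors).card := by
      have := Finset.le_card_sdiff M.primeFactors (Nat.primesLE ⌊y / 2⌋₊)
      rw [Nat.primesLE_card_eq_primeCounting] at this
      rw [sub_le_iff_le_add]
      exact_mod_cast (by omega : _ ≤ _)
    refine le_trans (b := ∑ p ∈ Nat.primesLE ⌊y / 2⌋₊ \ M.primeFactors, (1 / 2 : ℝ)) ?_ ?_
    · rw [Finset.sum_const, nsmul_eq_mul]
      linarith
    · refine Finset.sum_le_sum fun p hp => ?_
      simp only [Finset.mem_sdiff, Nat.mem_primesLE, Nat.mem_primeFactors] at hp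
      obtain ⟨⟨hpy, hpp⟩, hpM⟩ := hp
      have hcop : p.Coprime M := (Nat.Prime.coprime_iff_not_dvd hpp).2 fun h =>
        hpM ⟨hpp, h, NeZero.ne M⟩
      rw [if_pos ((ZMod.isUnit_iff_coprime p M).2 hcop),
        ArithmeticFunction.vonMangoldt_apply_prime hpp,
        div_self (Real.log_pos (by exact_mod_cast hpp.one_lt)).ne', one_mul]
      have : (p : ℝ) ≤ y / 2 := (Nat.le_floor_iff (by linarith)).1 hpy
      have : p / y ≤ 1 / 2 := by
        rw [div_le_iff₀ hy]; linarith
      linarith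
  · split_ifs
    · have h1 : (n : ℝ) ≤ y := (Nat.le_floor_iff hy.le).1 (Finset.mem_Icc.1 hn).2
      exact mul_nonneg (div_nonneg ArithmeticFunction.vonMangoldt_nonneg (Real.log_natCast_nonneg n))
        (sub_nonneg.2 (div_le_one_of_le₀ h1 hy.le))
    · exact le_rfl

open Classical in
theorem card_powers_le {g : ℤ} (hg : 2 ≤ |g|) {y : ℝ} (hy : 1 ≤ y) :
    (((Finset.Icc 1 ⌊y⌋₊).filter fun n : ℕ => ∃ k : ℕ, (n : ℤ) = g ^ k).card : ℝ) ≤ 5 * √y := by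
  have hsub : ((Finset.Icc 1 ⌊y⌋₊).filter fun n : ℕ => ∃ k : ℕ, (n : ℤ) = g ^ k) ⊆
      (Finset.range (Nat.log 2 ⌊y⌋₊ + 1)).image fun k => g.natAbs ^ k := by
    intro n hn
    obtain ⟨hn1, k, hk⟩ := Finset.mem_filter.1 hn
    have e : n = g.natAbs ^ k := by
      rw [← Int.natAbs_pow, ← hk, Int.natAbs_natCast]
    refine Finset.mem_image.2 ⟨k, Finset.mem_range.2 (Nat.lt_succ_of_le ?_), e.symm⟩
    refine Nat.le_log_of_pow_le one_lt_two ?_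
    refine le_trans ?_ (Finset.mem_Icc.1 hn1).2
    rw [e]
    exact Nat.pow_le_pow_left (by rw [Int.abs_eq_natAbs] at hg; exact_mod_cast hg) k
  have h1 := (Finset.card_le_card hsub).trans Finset.card_image_le
  rw [Finset.card_range] at h1
  have hfl : ⌊y⌋₊ ≠ 0 := (Nat.floor_pos.2 hy).ne'
  have h2 : (Nat.log 2 ⌊y⌋₊ : ℝ) * Real.log 2 ≤ Real.log y := by
    rw [← Real.log_pow]
    refine Real.log_le_log (by positivity) (le_trans ?_ (Nat.floor_le (by linarith)))
    exact_mod_cast Nat.pow_log_le_self 2 hfl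
  have h3 : Real.log y ≤ 2 * √y := by
    have h := Real.log_le_sub_one_of_pos (Real.sqrt_pos.2 (by linarith : 0 < y))
    rw [Real.log_sqrt (by linarith)] at h
    linarith
  have h4 : 1 ≤ √y := Real.one_le_sqrt.2 hy
  have hl2 := Real.log_two_gt_d9
  have h5 : (Nat.log 2 ⌊y⌋₊ : ℝ) ≤ 4 * √y := by
    nlinarith [Nat.cast_nonneg (α := ℝ) (Nat.log 2 ⌊y⌋₊)]
  calc _ ≤ ((Nat.log 2 ⌊y⌋₊ + 1 : ℕ) : ℝ) := by exact_mod_cast h1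
    _ ≤ _ := by push_cast; linarith

/-- The primes `p ≤ x` not dividing `g`. -/
noncomputable def goodPrimes (g : ℤ) (x : ℝ) : Finset ℕ :=
  (primesUpTo x).filter fun p : ℕ => ¬ ((p : ℤ) ∣ g)

theorem mem_goodPrimes {g : ℤ} {x : ℝ} (hx : 0 ≤ x) {p : ℕ} :
    p ∈ goodPrimes g x ↔ p.Prime ∧ (p : ℝ) ≤ x ∧ ¬ (p : ℤ) ∣ g := by
  simp only [goodPrimes, primesUpTo, Finset.mem_filter, Finset.mem_Iic, Nat.le_floor_iff hx]
  tauto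

theorem prime_of_mem_goodPrimes {g : ℤ} {x : ℝ} {p : ℕ} (hp : p ∈ goodPrimes g x) : p.Prime :=
  (Finset.mem_filter.1 (Finset.mem_filter.1 hp).1).2

theorem prod_goodPrimes_ne_zero (g : ℤ) (x : ℝ) : ∏ p ∈ goodPrimes g x, p ≠ 0 :=
  Finset.prod_ne_zero_iff.2 fun _ hp => (prime_of_mem_goodPrimes hp).ne_zero

theorem prod_goodPrimes_le (g : ℤ) (x : ℝ) : ∏ p ∈ goodPrimes g x, p ≤ 4 ^ ⌊x⌋₊ := by
  refine le_trans ?_ (primorial_le_four_pow ⌊x⌋₊)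
  rw [primorial]
  refine Finset.prod_le_prod_of_subset_of_one_le' (fun p hp => ?_) fun p hp _ =>
    (Finset.mem_filter.1 hp).2.one_le
  have := (Finset.mem_filter.1 hp).1
  simpa [primesUpTo, Nat.lt_succ_iff] using this

theorem primeFactors_prod_goodPrimes (g : ℤ) (x : ℝ) :
    (∏ p ∈ goodPrimes g x, p).primeFactors = goodPrimes g x :=
  Nat.primeFactors_prod fun _ hp => prime_of_mem_goodPrimes hp

theorem card_goodPrimes_le (g : ℤ) {x : ℝ} (hx : 0 ≤ x) : ((goodPrimes g x).card : ℝ) ≤ x := by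
  have h : goodPrimes g x ⊆ Finset.Icc 1 ⌊x⌋₊ := fun p hp => by
    have h1 := Finset.mem_filter.1 (Finset.mem_filter.1 hp).1
    exact Finset.mem_Icc.2 ⟨h1.2.one_le, Finset.mem_Iic.1 h1.1⟩
  have := Finset.card_le_card h
  rw [Nat.card_Icc, Nat.add_sub_cancel] at this
  exact (Nat.cast_le.2 this).trans (Nat.floor_le hx)

theorem isUnit_intCast_of_mem_goodPrimes {g : ℤ} {x : ℝ} {p : ℕ} (hp : p ∈ goodPrimes g x) :
    IsUnit (g : ZMod p) := by
  have : Fact p.Prime := ⟨prime_of_mem_goodPrimes hp⟩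
  rw [isUnit_iff_ne_zero, Ne, ZMod.intCast_zmod_eq_zero_iff_dvd]
  exact (Finset.mem_filter.1 hp).2

/-- The class of `g` in `(ZMod p)ˣ`. -/
noncomputable def baseUnit (g : ℤ) (x : ℝ) (p : goodPrimes g x) : (ZMod p)ˣ :=
  (isUnit_intCast_of_mem_goodPrimes p.2).unit

/-- The product of the quotients of `(ZMod p)ˣ` by the subgroup generated by `g`. -/
abbrev IndexGroup (g : ℤ) (x : ℝ) : Type :=
  (p : goodPrimes g x) → (ZMod p)ˣ ⧸ Subgroup.zpowers (baseUnit g x p)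

/-- Reduction of a unit modulo every good prime, up to powers of `g`. -/
noncomputable def toIndexGroup (g : ℤ) (x : ℝ) :
    (ZMod (∏ p ∈ goodPrimes g x, p))ˣ →* IndexGroup g x :=
  MonoidHom.pi fun p : goodPrimes g x =>
    (QuotientGroup.mk' (Subgroup.zpowers (baseUnit g x p))).comp
      (ZMod.unitsMap (Finset.dvd_prod_of_mem (fun i => i) p.2))

theorem card_quotient_zpowers_baseUnit (g : ℤ) (x : ℝ) (p : goodPrimes g x) :
    Nat.card ((ZMod p)ˣ ⧸ Subgroup.zpowers (baseUnit g x p)) = (p - 1) / orderOf (g : ZMod p) := by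
  have : Fact (p : ℕ).Prime := ⟨prime_of_mem_goodPrimes p.2⟩
  have h := Subgroup.card_mul_index (Subgroup.zpowers (baseUnit g x p))
  rw [Nat.card_zpowers, Nat.card_eq_fintype_card, ZMod.card_units, ← orderOf_units,
    baseUnit, IsUnit.unit_spec] at h
  refine (Nat.div_eq_of_eq_mul_right ?_ h.symm).symm
  refine Nat.pos_of_ne_zero fun h0 => ?_
  rw [h0, zero_mul] at h
  have := (prime_of_mem_goodPrimes p.2).two_le
  omega

theorem finite_indexGroup (g : ℤ) (x : ℝ) : Finite (IndexGroup g x) := by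
  have (p : goodPrimes g x) : NeZero (p : ℕ) := ⟨(prime_of_mem_goodPrimes p.2).ne_zero⟩
  infer_instance

theorem card_indexGroup (g : ℤ) (x : ℝ) : Nat.card (IndexGroup g x) = Ig g x := by
  rw [Nat.card_pi, Ig, ← goodPrimes,
    ← Finset.prod_coe_sort (goodPrimes g x) fun p => (p - 1) / orderOf (g : ZMod p)]
  exact Finset.prod_congr rfl fun p _ => card_quotient_zpowers_baseUnit g x p

theorem one_le_Ig (g : ℤ) (x : ℝ) : 1 ≤ Ig g x := by
  have := finite_indexGroup g x
  rw [← card_indexGroup]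
  exact Nat.card_pos

theorem Ig_le (g : ℤ) (x : ℝ) : Ig g x ≤ 4 ^ ⌊x⌋₊ := by
  refine le_trans ?_ (prod_goodPrimes_le g x)
  exact Finset.prod_le_prod' fun p _ => (Nat.div_le_self _ _).trans (Nat.sub_le _ _)

theorem exists_modEq_pow_of_toIndexGroup_eq_one {g : ℤ} {x : ℝ}
    {u : (ZMod (∏ p ∈ goodPrimes g x, p))ˣ} (hu : toIndexGroup g x u = 1) {n : ℕ}
    (hn : (u : ZMod (∏ p ∈ goodPrimes g x, p)) = n) {p : ℕ} (hp : p ∈ goodPrimes g x) :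
    ∃ k : ℕ, (n : ℤ) ≡ g ^ k [ZMOD (p : ℕ)] := by
  have : Fact p.Prime := ⟨prime_of_mem_goodPrimes hp⟩
  have hdvd : p ∣ ∏ p ∈ goodPrimes g x, p := Finset.dvd_prod_of_mem (fun i => i) hp
  have h : ZMod.unitsMap hdvd u ∈ Subgroup.zpowers (baseUnit g x ⟨p, hp⟩) :=
    (QuotientGroup.eq_one_iff _).1 (congrFun hu ⟨p, hp⟩)
  rw [← mem_powers_iff_mem_zpowers] at h
  obtain ⟨k, hk⟩ := h
  refine ⟨k, (ZMod.intCast_eq_intCast_iff _ _ _).1 ?_⟩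
  have h2 : (g : ZMod p) ^ k = ZMod.castHom hdvd (ZMod p) u := congrArg Units.val hk
  rw [hn, map_natCast] at h2
  push_cast
  exact h2.symm

theorem GRH.LFunction_ne_zero (hRH : GRH) {N : ℕ} [NeZero N] {χ : DirichletCharacter ℂ N}
    (hχ : χ ≠ 1) {s : ℂ} (hs : 1 / 2 < s.re) : χ.LFunction s ≠ 0 := by
  intro h
  rcases lt_or_ge s.re 1 with h1 | h1
  · exact hs.ne' (hRH N χ s h (by linarith) h1)
  · exact DirichletCharacter.LFunction_ne_zero_of_one_le_re χ (Or.inl hχ) h1 h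

theorem log_le_two_mul_of_le_four_pow {m : ℕ} {x : ℝ} (hx : 0 ≤ x) (hm : m ≤ 4 ^ ⌊x⌋₊) :
    Real.log m ≤ 2 * x := by
  rcases Nat.eq_zero_or_pos m with rfl | h0
  · simpa using hx
  have h1 : Real.log m ≤ Real.log ((4 : ℝ) ^ ⌊x⌋₊) :=
    Real.log_le_log (by exact_mod_cast h0) (by exact_mod_cast hm)
  have h2 : Real.log 4 ≤ 2 := by
    rw [show (4 : ℝ) = 2 ^ 2 by norm_num, Real.log_pow]
    have := Real.log_two_lt_d9
    push_cast
    linarith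
  rw [Real.log_pow] at h1
  have h3 := Nat.floor_le hx
  nlinarith [Nat.cast_nonneg (α := ℝ) ⌊x⌋₊]

theorem mul_sqrt_lt_div_log {c x I s y : ℝ} (hc : 1 ≤ c) (hx : 1 ≤ x) (hI : 1 ≤ I)
    (hlog : Real.log I ≤ 2 * x) (hs : s = (1000 * c) ^ 2 * I * x ^ 2) (hy : y = s ^ 2) :
    I * (c * x * s) < (y / (10 * Real.log y) - x) / 2 := by
  have hc2 : 0 < (1000 * c) ^ 2 := by positivity
  have hx2 : 1 ≤ x ^ 2 := one_le_pow₀ hx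
  have hs1 : 10 ^ 6 * (c ^ 2 * x ^ 2) ≤ s := by
    rw [hs]
    have : 0 ≤ (c ^ 2 * x ^ 2) * (I - 1) := mul_nonneg (by positivity) (by linarith)
    nlinarith
  have hcx : 1 ≤ c * x := one_le_mul_of_one_le_of_one_le hc hx
  have hcx2 : c * x ≤ c ^ 2 * x ^ 2 := by nlinarith
  have hs2 : 1 < s := by nlinarith
  have hlogs : Real.log s = 2 * Real.log (1000 * c) + Real.log I + 2 * Real.log x := by
    rw [hs, Real.log_mul (by positivity) (by positivity),
      Real.log_mul (by positivity) (by positivity), Real.log_pow, Real.log_pow]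
    push_cast
    ring
  have hlogy : Real.log y = 2 * Real.log s := by
    rw [hy, Real.log_pow]
    push_cast
    ring
  have h1 := Real.log_le_self (x := 1000 * c) (by positivity)
  have h2 := Real.log_le_self (x := x) (by positivity)
  have hL : Real.log y ≤ 4008 * (c * x) := by nlinarith
  have hL0 : 0 < Real.log y := by
    rw [hlogy]
    have := Real.log_pos hs2
    linarith
  have hxy : x ≤ y / (20 * Real.log y) := by
    have : x * Real.log y ≤ 4008 * (c ^ 2 * x ^ 2) :=
      calc x * Real.log y ≤ x * (4008 * (c * x)) := by gcongr
        _ = 4008 * (1 * (c * x ^ 2)) := by ring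
        _ ≤ 4008 * (c * (c * x ^ 2)) := by gcongr
        _ = _ := by ring
    rw [le_div_iff₀ (by positivity)]
    nlinarith
  have hmain : I * (c * x * s) < y / (40 * Real.log y) := by
    rw [lt_div_iff₀ (by positivity)]
    calc I * (c * x * s) * (40 * Real.log y) ≤ I * (c * x * s) * (40 * (4008 * (c * x))) := by
          gcongr
      _ = 160320 * (c ^ 2 * I * x ^ 2) * s := by ring
      _ < 10 ^ 6 * (c ^ 2 * I * x ^ 2) * s := by
          have : 0 < c ^ 2 * I * x ^ 2 := by positivity
          gcongr
          norm_num
      _ = y := by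
          rw [hy, sq s]
          nth_rewrite 2 [hs]
          ring
  have e1 : y / (10 * Real.log y) = 4 * (y / (40 * Real.log y)) := by
    field_simp
    ring
  have e2 : y / (20 * Real.log y) = 2 * (y / (40 * Real.log y)) := by
    field_simp
    ring
  rw [e1]
  rw [e2] at hxy
  linarith

theorem vonMangoldt_div_log_mul_le_one {n : ℕ} {y : ℝ} (hy : 0 < y) (hn : (n : ℝ) ≤ y) :
    ArithmeticFunction.vonMangoldt n / Real.log n * (1 - n / y) ≤ 1 := by
  have h1 : ArithmeticFunction.vonMangoldt n / Real.log n ≤ 1 :=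
    div_le_one_of_le₀ ArithmeticFunction.vonMangoldt_le_log (Real.log_natCast_nonneg n)
  have h2 : (n : ℝ) / y ≤ 1 := (div_le_one hy).2 hn
  have h3 : 0 ≤ (n : ℝ) / y := by positivity
  exact mul_le_one₀ h1 (by linarith) (by linarith)

theorem sum_le_of_forall_exists_pow {g : ℤ} (hg : 2 ≤ |g|) {y : ℝ} (hy : 1 ≤ y) {P : ℕ → Prop}
    [DecidablePred P]
    (hP : ∀ n : ℕ, 0 < n → (n : ℝ) ≤ y → P n → ∃ k : ℕ, (n : ℤ) = g ^ k) :
    ∑ n ∈ Finset.Icc 1 ⌊y⌋₊, (if P n then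
      ArithmeticFunction.vonMangoldt n / Real.log n * (1 - n / y) else 0) ≤ 5 * √y := by
  classical
  refine le_trans ?_ (card_powers_le hg hy)
  rw [Finset.card_filter, Nat.cast_sum]
  refine Finset.sum_le_sum fun n hn => ?_
  have hn' := Finset.mem_Icc.1 hn
  have hny : (n : ℝ) ≤ y := (Nat.le_floor_iff (by linarith)).1 hn'.2
  by_cases h : P n
  · rw [if_pos h, if_pos (hP n hn'.1 hny h), Nat.cast_one]
    exact vonMangoldt_div_log_mul_le_one (by linarith) hny
  · rw [if_neg h]
    positivity

open Classical in
theorem sum_isUnit_le_natCard_mul {M : ℕ} [NeZero M] {Q : Type*} [CommGroup Q] [Finite Q]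
    (h0 : ∀ χ : DirichletCharacter ℂ M, χ ≠ 1 → ∀ s : ℂ, 1 / 2 < s.re → χ.LFunction s ≠ 0)
    (π : (ZMod M)ˣ →* Q) {y : ℝ} (hy : 1 ≤ y) :
    ∑ n ∈ Finset.Icc 1 ⌊y⌋₊, (if IsUnit (n : ZMod M) then
      ArithmeticFunction.vonMangoldt n / Real.log n * (1 - n / y) else 0) ≤
    Nat.card Q * (∑ n ∈ Finset.Icc 1 ⌊y⌋₊, (if ∃ u, π u = 1 ∧ (u : ZMod M) = n then
      ArithmeticFunction.vonMangoldt n / Real.log n * (1 - n / y) else 0) +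
      (78 * Real.log (2 * M) + (1296 * tailIntegral + 98)) * √y) := by
  let := Fintype.ofFinite π.range
  have h := DirichletCharacter.sum_isUnit_le_card_mul h0 π.rangeRestrict_surjective hy
  simp only [Subtype.ext_iff, MonoidHom.coe_rangeRestrict, OneMemClass.coe_one] at h
  refine h.trans (mul_le_mul_of_nonneg_right ?_ (add_nonneg (Finset.sum_nonneg fun n hn => ?_) ?_))
  · rw [← Nat.card_eq_fintype_card]
    exact_mod_cast Subgroup.card_le_card_group _
  · have hny : (n : ℝ) / y ≤ 1 := (div_le_one (by linarith)).2
      ((Nat.le_floor_iff (by linarith)).1 (Finset.mem_Icc.1 hn).2)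
    split_ifs
    · exact mul_nonneg (div_nonneg ArithmeticFunction.vonMangoldt_nonneg
        (Real.log_natCast_nonneg n)) (by linarith)
    · exact le_rfl
  · have h1 := tailIntegral_nonneg
    have h2 : 0 ≤ Real.log (2 * M) := by exact_mod_cast Real.log_natCast_nonneg (2 * M)
    positivity

theorem primeCounting_le_of_forall_exists_pow {M : ℕ} [NeZero M] {Q : Type*} [CommGroup Q]
    [Finite Q]
    (h0 : ∀ χ : DirichletCharacter ℂ M, χ ≠ 1 → ∀ s : ℂ, 1 / 2 < s.re → χ.LFunction s ≠ 0)
    (π : (ZMod M)ˣ →* Q) {g : ℤ} (hg : 2 ≤ |g|) {y : ℝ} (hy : 1 ≤ y)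
    (hπ : ∀ (n : ℕ) (u : (ZMod M)ˣ), 0 < n → (n : ℝ) ≤ y → π u = 1 → (u : ZMod M) = n →
      ∃ k : ℕ, (n : ℤ) = g ^ k) :
    ((Nat.primeCounting ⌊y / 2⌋₊ : ℝ) - M.primeFactors.card) / 2 ≤
      Nat.card Q * ((78 * Real.log (2 * M) + (1296 * tailIntegral + 103)) * √y) := by
  classical
  refine (le_sum_isUnit_vonMangoldt (by linarith)).trans
    ((sum_isUnit_le_natCard_mul h0 π hy).trans ?_)
  refine mul_le_mul_of_nonneg_left ?_ (Nat.cast_nonneg _)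
  rw [show ∀ a b : ℝ, (a + (b + 103)) * √y = 5 * √y + (a + (b + 98)) * √y by intros; ring]
  gcongr
  exact sum_le_of_forall_exists_pow hg hy fun n hn hny ⟨u, hu, hun⟩ => hπ n u hn hny hu hun

theorem log_two_mul_prod_goodPrimes_le (g : ℤ) {x : ℝ} (hx : 1 ≤ x) :
    Real.log (2 * (∏ p ∈ goodPrimes g x, p : ℕ)) ≤ 3 * x := by
  have h0 : ((∏ p ∈ goodPrimes g x, p : ℕ) : ℝ) ≠ 0 := by
    exact_mod_cast prod_goodPrimes_ne_zero g x
  rw [Real.log_mul two_ne_zero h0]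
  have h1 := log_le_two_mul_of_le_four_pow (by linarith) (prod_goodPrimes_le g x)
  have h2 := Real.log_two_lt_d9
  linarith

theorem exists_le_of_GRH (hRH : GRH) {g : ℤ} (hg : 2 ≤ |g|) {x : ℝ} (hx : 3 ≤ x) :
    ∃ n : ℕ, (n : ℝ) ≤ (1000 * (337 + 1296 * tailIntegral)) ^ 4 * (Ig g x : ℝ) ^ 2 * x ^ 4 ∧
      0 < n ∧ (¬ ∃ k : ℕ, (n : ℤ) = g ^ k) ∧
      ∀ p : ℕ, p.Prime → (p : ℝ) ≤ x → ¬ ((p : ℤ) ∣ g) →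
        ∃ k : ℕ, (n : ℤ) ≡ g ^ k [ZMOD (p : ℕ)] := by
  set J := tailIntegral
  set c : ℝ := 337 + 1296 * J with hcdef
  have hJ : 0 ≤ J := tailIntegral_nonneg
  have hc : 337 ≤ c := by linarith
  have hI : (1 : ℝ) ≤ Ig g x := by exact_mod_cast one_le_Ig g x
  set s : ℝ := (1000 * c) ^ 2 * Ig g x * x ^ 2 with hs
  set y : ℝ := (1000 * c) ^ 4 * (Ig g x : ℝ) ^ 2 * x ^ 4 with hydef
  have hys : y = s ^ 2 := by rw [hydef, hs]; ring
  have hs0 : 20 ≤ s :=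
    calc (20 : ℝ) ≤ (1000 * 337) ^ 2 * 1 * 3 ^ 2 := by norm_num
      _ ≤ s := by rw [hs]; gcongr
  have hy : 20 ≤ y := by nlinarith
  have hsqrt : √y = s := by rw [hys, Real.sqrt_sq (by linarith)]
  by_contra! hcon
  set M := ∏ p ∈ goodPrimes g x, p
  have : NeZero M := ⟨prod_goodPrimes_ne_zero g x⟩
  have := finite_indexGroup g x
  have hlow := primeCounting_le_of_forall_exists_pow (M := M) (Q := IndexGroup g x)
    (fun χ hχ s hs => hRH.LFunction_ne_zero hχ hs) (toIndexGroup g x) hg (y := y) (by linarith)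
    fun n u hn hny hu hun => by
      by_contra hpow
      obtain ⟨p, hp, hpx, hpg, hk⟩ := hcon n hny hn (by simpa using hpow)
      obtain ⟨k, h⟩ := exists_modEq_pow_of_toIndexGroup_eq_one hu hun
        ((mem_goodPrimes (by linarith)).2 ⟨hp, hpx, hpg⟩)
      exact hk k h
  rw [primeFactors_prod_goodPrimes, card_indexGroup, hsqrt] at hlow
  have hprimes := div_log_le_primeCounting hy
  have hgood := card_goodPrimes_le g (x := x) (by linarith)
  have hlogM := log_two_mul_prod_goodPrimes_le g (x := x) (by linarith)
  have hfin := mul_sqrt_lt_div_log (c := c) (x := x) (by linarith) (by linarith) hI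
    (log_le_two_mul_of_le_four_pow (by linarith) (Ig_le g x)) hs hys
  have hbound : 78 * Real.log (2 * M) + (1296 * J + 103) ≤ c * x := by
    have : J ≤ J * x := le_mul_of_one_le_right hJ (by linarith)
    rw [hcdef]
    linarith
  have hup : (Ig g x : ℝ) * ((78 * Real.log (2 * M) + (1296 * J + 103)) * s) ≤
      Ig g x * (c * x * s) := by gcongr
  linarith

end

/-- Assume the Riemann Hypothesis for all Dirichlet `L`-functions (the Prop `GRH` above).
For each fixed `g` with `|g| ≥ 2` there is a constant `C_g` such that for `x ≥ 3`,
`p_g(x) ≤ C_g · I_g(x)² · x⁴` (and in particular such an integer exists). -/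
theorem pg_bound (hRH : GRH) (g : ℤ) (hg : 2 ≤ |g|) :
    ∃ C : ℝ, ∀ x : ℝ, 3 ≤ x →
      {n : ℕ | 0 < n ∧ (¬ ∃ k : ℕ, (n : ℤ) = g ^ k) ∧
        ∀ p : ℕ, p.Prime → (p : ℝ) ≤ x → ¬ ((p : ℤ) ∣ g) →
          ∃ k : ℕ, (n : ℤ) ≡ g ^ k [ZMOD (p : ℕ)]}.Nonempty ∧
      (pg g x : ℝ) ≤ C * (Ig g x : ℝ) ^ 2 * x ^ 4 := by
  refine ⟨(1000 * (337 + 1296 * tailIntegral)) ^ 4, fun x hx => ?_⟩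
  obtain ⟨n, hn, hmem⟩ := exists_le_of_GRH hRH hg hx
  exact ⟨⟨n, hmem⟩, (Nat.cast_le.2 (Nat.sInf_le hmem)).trans hn⟩
end

section
/- Let g be a fixed integer with |g| ≥ 2. As x → ∞, the number of x-pseudopowers to base g in the interval (0, M(x)] satisfies #(P_x ∩ (0, M(x)]) = (1+o(1)) · 2^{ω(g)} M(x) / (e^γ φ(rad(g)) I_g(x) log x). -/
open scoped BigOperators

/-- `#(P_x ∩ (A, A+N])`: the number of `x`-pseudopowers to base `g` in `(A, A+N]`. -/
noncomputable def pseudopowersIn (g : ℤ) (x A N : ℝ) : ℕ :=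
  Set.ncard {n : ℕ | IsPseudopower g x n ∧ A < (n : ℝ) ∧ (n : ℝ) ≤ A + N}

/-- `rad(g)`: the product of the distinct primes dividing `g`. -/
noncomputable def radical (g : ℤ) : ℕ := ∏ p ∈ g.natAbs.primeFactors, p

open Filter Topology

/-- The weight `-log (1 - 1/p)` at a prime `p`, and `0` elsewhere. -/
noncomputable def eulerWeight (n : ℕ) : ℝ :=
  if n.Prime then -Real.log (1 - (n : ℝ)⁻¹) else 0

lemma inv_le_neg_log_one_sub {u : ℝ} (hu1 : u < 1) : u ≤ -Real.log (1 - u) := by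
  linarith [Real.log_le_sub_one_of_pos (sub_pos.2 hu1)]

lemma neg_log_one_sub_le {u : ℝ} (hu1 : u < 1) : -Real.log (1 - u) ≤ u / (1 - u) := by
  have h := Real.one_sub_inv_le_log_of_pos (sub_pos.2 hu1)
  have h1 : 1 - u ≠ 0 := (sub_pos.2 hu1).ne'
  have h2 : u / (1 - u) = (1 - u)⁻¹ - 1 := by field_simp; ring
  linarith

lemma neg_log_one_sub_le_add_sq {u : ℝ} (hu1 : u ≤ 1 / 2) :
    -Real.log (1 - u) ≤ u + 2 * u ^ 2 := by
  refine (neg_log_one_sub_le (by linarith)).trans ?_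
  rw [div_le_iff₀ (by linarith)]
  nlinarith [sq_nonneg u]

lemma inv_natCast_le_half {n : ℕ} (hn : 2 ≤ n) : (n : ℝ)⁻¹ ≤ 1 / 2 := by
  rw [one_div]
  exact inv_anti₀ (by norm_num) (by exact_mod_cast hn)

lemma eulerWeight_nonneg (n : ℕ) : 0 ≤ eulerWeight n := by
  unfold eulerWeight
  split_ifs with h
  · have := inv_natCast_le_half h.two_le
    exact le_trans (by positivity) (inv_le_neg_log_one_sub (u := (n : ℝ)⁻¹) (by linarith))
  · rfl

lemma eulerWeight_le (n : ℕ) : eulerWeight n ≤ 2 * (n : ℝ)⁻¹ := by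
  unfold eulerWeight
  split_ifs with h
  · have h1 := inv_natCast_le_half h.two_le
    have h2 : 0 ≤ (n : ℝ)⁻¹ := by positivity
    have := neg_log_one_sub_le_add_sq h1
    nlinarith
  · positivity

lemma log_factorial_eq_sum_primesLE (N : ℕ) :
    Real.log (N.factorial : ℝ) =
      ∑ p ∈ N.primesLE, (N.factorial.factorization p : ℝ) * Real.log p := by
  rw [Real.log_nat_eq_sum_factorization, Finsupp.sum, Nat.support_factorization]
  refine Finset.sum_subset ?_ ?_
  · intro p hp
    have hp' := Nat.prime_of_mem_primeFactors hp
    exact Nat.mem_primesLE.2 ⟨(hp'.dvd_factorial).1 (Nat.dvd_of_mem_primeFactors hp), hp'⟩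
  · intro p _ hp
    rw [← Nat.support_factorization, Finsupp.notMem_support_iff] at hp
    simp [hp]

lemma div_sub_one_le_factorization_factorial {N p : ℕ} (hp : p.Prime) :
    (N : ℝ) / p - 1 ≤ N.factorial.factorization p := by
  have h1 : N / p ≤ N.factorial.factorization p := by
    rw [Nat.factorization_factorial hp (b := Nat.log p N + 2) (by omega)]
    refine le_trans (by simp) (Finset.single_le_sum (f := fun i => N / p ^ i)
      (fun _ _ => Nat.zero_le _) (Finset.mem_Ico.2 ⟨le_refl 1, by omega⟩))
  have h2 : (N : ℝ) / p < (N / p : ℕ) + 1 := by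
    have hp0 : (0 : ℝ) < p := by exact_mod_cast hp.pos
    rw [div_lt_iff₀ hp0]
    have := Nat.lt_div_mul_add (a := N) hp.pos
    have h3 : (N : ℝ) < (N / p : ℕ) * p + p := by exact_mod_cast this
    linarith
  have h3 : ((N / p : ℕ) : ℝ) ≤ N.factorial.factorization p := by exact_mod_cast h1
  linarith

lemma factorization_factorial_le_div {N p : ℕ} (hN : N ≠ 0) (hp : p.Prime) :
    (N.factorial.factorization p : ℝ) ≤ (N : ℝ) / (p - 1) := by
  have := Fact.mk hp
  have h := (sub_one_mul_padicValNat_factorial_lt_of_ne_zero p hN).le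
  rw [← Nat.factorization_def _ hp] at h
  have h1 : (1 : ℝ) < p := by exact_mod_cast hp.one_lt
  rw [le_div_iff₀ (by linarith)]
  have h2 : (((p - 1 : ℕ) : ℝ)) * N.factorial.factorization p ≤ N := by exact_mod_cast h
  rw [Nat.cast_sub hp.one_le] at h2
  push_cast at h2
  linarith

lemma sum_log_div_le (N : ℕ) (hN : N ≠ 0) :
    ∑ p ∈ N.primesLE, Real.log p / p ≤ Real.log N + Real.log 4 := by
  have hN0 : (0 : ℝ) < N := by positivity
  have h1 : ∑ p ∈ N.primesLE, ((N : ℝ) / p - 1) * Real.log p ≤ Real.log (N.factorial : ℝ) := by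
    rw [log_factorial_eq_sum_primesLE]
    refine Finset.sum_le_sum fun p hp => ?_
    have hp := (Nat.mem_primesLE.1 hp).2
    exact mul_le_mul_of_nonneg_right (div_sub_one_le_factorization_factorial hp)
      (Real.log_natCast_nonneg p)
  have h2 : Real.log (N.factorial : ℝ) ≤ N * Real.log N := by
    rw [← Real.log_pow]
    exact Real.log_le_log (by positivity) (by exact_mod_cast Nat.factorial_le_pow N)
  have h3 := Chebyshev.theta_le_log4_mul_x hN0.le
  rw [Chebyshev.theta_eq_sum_primesLE_log] at h3
  have h4 : ∑ p ∈ N.primesLE, ((N : ℝ) / p - 1) * Real.log p =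
      N * ∑ p ∈ N.primesLE, Real.log p / p - ∑ p ∈ N.primesLE, Real.log (p : ℝ) := by
    rw [Finset.mul_sum, ← Finset.sum_sub_distrib]
    exact Finset.sum_congr rfl fun p _ => by ring
  refine le_of_mul_le_mul_left ?_ hN0
  nlinarith

lemma le_sum_log_div_sub_one (N : ℕ) (hN : N ≠ 0) :
    Real.log N - 1 ≤ ∑ p ∈ N.primesLE, Real.log p / ((p : ℝ) - 1) := by
  have hN0 : (0 : ℝ) < N := by positivity
  have h1 : Real.log (N.factorial : ℝ) ≤ ∑ p ∈ N.primesLE, ((N : ℝ) / (p - 1)) * Real.log p := by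
    rw [log_factorial_eq_sum_primesLE]
    refine Finset.sum_le_sum fun p hp => ?_
    have hp := (Nat.mem_primesLE.1 hp).2
    exact mul_le_mul_of_nonneg_right (factorization_factorial_le_div hN hp)
      (Real.log_natCast_nonneg p)
  have h2 := Stirling.le_log_factorial_stirling hN
  have h3 : 0 ≤ Real.log N := Real.log_natCast_nonneg N
  have h4 : 0 ≤ Real.log (2 * Real.pi) := Real.log_nonneg (by linarith [Real.pi_gt_three])
  have h5 : ∑ p ∈ N.primesLE, ((N : ℝ) / (p - 1)) * Real.log p =
      N * ∑ p ∈ N.primesLE, Real.log p / ((p : ℝ) - 1) := by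
    rw [Finset.mul_sum]
    exact Finset.sum_congr rfl fun p _ => by ring
  refine le_of_mul_le_mul_left ?_ hN0
  nlinarith

lemma log_div_sub_one_sub_log_div_le {n : ℕ} (hn : 2 ≤ n) :
    Real.log n / ((n : ℝ) - 1) - Real.log n / n ≤ 4 * (1 / (n : ℝ) ^ (3 / 2 : ℝ)) := by
  have h2 : (2 : ℝ) ≤ n := by exact_mod_cast hn
  have h0 : (0 : ℝ) < n := by linarith
  have hlog := Real.log_le_rpow_div h0.le (show (0 : ℝ) < 1 / 2 by norm_num)
  have hpow : (n : ℝ) ^ (3 / 2 : ℝ) * (n : ℝ) ^ (1 / 2 : ℝ) = n ^ 2 := by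
    rw [← Real.rpow_add h0]; norm_num
  have hA : 0 < (n : ℝ) ^ (3 / 2 : ℝ) := by positivity
  have hB : 0 < (n : ℝ) ^ (1 / 2 : ℝ) := by positivity
  have e : Real.log n / ((n : ℝ) - 1) - Real.log n / n = Real.log n / (n * (n - 1)) := by
    have : (n : ℝ) - 1 ≠ 0 := by linarith
    field_simp; ring
  rw [e, mul_one_div, div_le_div_iff₀ (by nlinarith) hA]
  calc Real.log n * (n : ℝ) ^ (3 / 2 : ℝ)
      ≤ ((n : ℝ) ^ (1 / 2 : ℝ) / (1 / 2)) * (n : ℝ) ^ (3 / 2 : ℝ) := by gcongr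
    _ = 2 * n ^ 2 := by rw [← hpow]; ring
    _ ≤ 4 * (n * (n - 1)) := by nlinarith

lemma exists_abs_sum_eulerWeight_mul_log_sub_log_le :
    ∃ C : ℝ, ∀ N : ℕ, N ≠ 0 →
      |∑ n ∈ Finset.range (N + 1), eulerWeight n * Real.log n - Real.log N| ≤ C := by
  have hsum : Summable fun n : ℕ => 4 * (1 / (n : ℝ) ^ (3 / 2 : ℝ)) :=
    (Real.summable_one_div_nat_rpow.2 (by norm_num)).mul_left 4
  set K := ∑' n : ℕ, 4 * (1 / (n : ℝ) ^ (3 / 2 : ℝ)) with hK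
  have hK0 : 0 ≤ K := tsum_nonneg fun n => by positivity
  have h4 : 0 ≤ Real.log 4 := Real.log_nonneg (by norm_num)
  refine ⟨1 + Real.log 4 + K, fun N hN => ?_⟩
  have hdiff : ∑ p ∈ N.primesLE, Real.log p / ((p : ℝ) - 1) -
      ∑ p ∈ N.primesLE, Real.log p / (p : ℝ) ≤ K := by
    rw [← Finset.sum_sub_distrib]
    refine le_trans (Finset.sum_le_sum fun p hp =>
      log_div_sub_one_sub_log_div_le (Nat.mem_primesLE.1 hp).2.two_le) ?_
    exact hsum.sum_le_tsum _ fun n _ => by positivity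
  have hS : ∑ n ∈ Finset.range (N + 1), eulerWeight n * Real.log n =
      ∑ p ∈ N.primesLE, -Real.log (1 - (p : ℝ)⁻¹) * Real.log p := by
    have : N.primesLE = (Finset.range (N + 1)).filter Nat.Prime := by
      ext p; simp [Nat.mem_primesLE]
    rw [this, Finset.sum_filter]
    exact Finset.sum_congr rfl fun n _ => by unfold eulerWeight; split_ifs <;> simp
  have hlow : ∑ p ∈ N.primesLE, Real.log p / (p : ℝ) ≤
      ∑ p ∈ N.primesLE, -Real.log (1 - (p : ℝ)⁻¹) * Real.log p := by
    refine Finset.sum_le_sum fun p hp => ?_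
    have hp := inv_natCast_le_half (Nat.mem_primesLE.1 hp).2.two_le
    rw [div_eq_inv_mul]
    exact mul_le_mul_of_nonneg_right (inv_le_neg_log_one_sub (by linarith))
      (Real.log_natCast_nonneg p)
  have hup : ∑ p ∈ N.primesLE, -Real.log (1 - (p : ℝ)⁻¹) * Real.log p ≤
      ∑ p ∈ N.primesLE, Real.log p / ((p : ℝ) - 1) := by
    refine Finset.sum_le_sum fun p hp => ?_
    have h2 := (Nat.mem_primesLE.1 hp).2.two_le
    have hp := inv_natCast_le_half h2
    have h2' : (2 : ℝ) ≤ p := by exact_mod_cast h2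
    have e : (p : ℝ)⁻¹ / (1 - (p : ℝ)⁻¹) = 1 / ((p : ℝ) - 1) := by
      have : (p : ℝ) - 1 ≠ 0 := by linarith
      field_simp
    have := neg_log_one_sub_le (u := (p : ℝ)⁻¹) (by linarith)
    rw [e] at this
    refine (mul_le_mul_of_nonneg_right this (Real.log_natCast_nonneg p)).trans_eq (by ring)
  have h1 := sum_log_div_le N hN
  have h2 := le_sum_log_div_sub_one N hN
  rw [hS, abs_le]
  constructor <;> linarith

lemma log_mul_log_log_succ_sub_bounds {k : ℕ} (hk : 2 ≤ k) :
    Real.log k * (Real.log (Real.log (k + 1)) - Real.log (Real.log k)) ≤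
      Real.log (k + 1) - Real.log k ∧
    Real.log (k + 1) - Real.log k - 1 / (k : ℝ) ^ 2 ≤
      Real.log k * (Real.log (Real.log (k + 1)) - Real.log (Real.log k)) := by
  have h2 : (2 : ℝ) ≤ k := by exact_mod_cast hk
  have ha : 0 < Real.log k := Real.log_pos (by linarith)
  have hb1 : 1 ≤ Real.log ((k : ℝ) + 1) := by
    rw [Real.le_log_iff_exp_le (by linarith)]
    linarith [Real.exp_one_lt_three]
  have hab : Real.log (k : ℝ) ≤ Real.log ((k : ℝ) + 1) :=
    Real.log_le_log (by linarith) (by linarith)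
  have hδ : Real.log ((k : ℝ) + 1) - Real.log k ≤ 1 / k := by
    rw [← Real.log_div (by linarith) (by linarith)]
    refine (Real.log_le_sub_one_of_pos (by positivity)).trans_eq ?_
    field_simp; ring
  set a := Real.log (k : ℝ)
  set b := Real.log ((k : ℝ) + 1)
  have hb : 0 < b := by linarith
  rw [← Real.log_div hb.ne' ha.ne']
  constructor
  · have := Real.log_le_sub_one_of_pos (show 0 < b / a by positivity)
    calc a * Real.log (b / a) ≤ a * (b / a - 1) := by gcongr
      _ = b - a := by field_simp
  · have h := Real.one_sub_inv_le_log_of_pos (show 0 < b / a by positivity)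
    have h3 : (b - a) ^ 2 ≤ 1 / (k : ℝ) ^ 2 := by
      rw [← one_div_pow]
      exact pow_le_pow_left₀ (by linarith) hδ 2
    calc b - a - 1 / (k : ℝ) ^ 2 ≤ b - a - (b - a) ^ 2 / b := by
          have : (b - a) ^ 2 / b ≤ (b - a) ^ 2 := div_le_self (sq_nonneg _) hb1
          linarith
      _ = a * (1 - (b / a)⁻¹) := by field_simp; ring
      _ ≤ a * Real.log (b / a) := by gcongr

lemma exists_abs_sum_log_mul_log_log_sub_le :
    ∃ C : ℝ, ∀ n : ℕ, |∑ i ∈ Finset.range n, Real.log (i + 2 : ℕ) *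
      (Real.log (Real.log (i + 3 : ℕ)) - Real.log (Real.log (i + 2 : ℕ))) -
        Real.log (n + 2 : ℕ)| ≤ C := by
  have hsum : Summable fun n : ℕ => 1 / ((n + 2 : ℕ) : ℝ) ^ 2 :=
    (summable_nat_add_iff 2).2 (Real.summable_one_div_nat_pow.2 one_lt_two)
  refine ⟨Real.log 2 + ∑' n : ℕ, 1 / ((n + 2 : ℕ) : ℝ) ^ 2, fun n => ?_⟩
  have htel : ∑ i ∈ Finset.range n, (Real.log (i + 3 : ℕ) - Real.log (i + 2 : ℕ)) =
      Real.log (n + 2 : ℕ) - Real.log 2 := by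
    have := Finset.sum_range_sub (fun i : ℕ => Real.log (i + 2 : ℕ)) n
    simpa [add_assoc, add_comm, add_left_comm] using this
  have hcast (i : ℕ) : ((i + 3 : ℕ) : ℝ) = ((i + 2 : ℕ) : ℝ) + 1 := by push_cast; ring
  have h1 : ∑ i ∈ Finset.range n, Real.log (i + 2 : ℕ) *
      (Real.log (Real.log (i + 3 : ℕ)) - Real.log (Real.log (i + 2 : ℕ))) ≤
      ∑ i ∈ Finset.range n, (Real.log (i + 3 : ℕ) - Real.log (i + 2 : ℕ)) := by
    refine Finset.sum_le_sum fun i _ => ?_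
    rw [hcast]
    exact (log_mul_log_log_succ_sub_bounds (by omega)).1
  have h2 : ∑ i ∈ Finset.range n, (Real.log (i + 3 : ℕ) - Real.log (i + 2 : ℕ)) -
      ∑ i ∈ Finset.range n, 1 / ((i + 2 : ℕ) : ℝ) ^ 2 ≤
      ∑ i ∈ Finset.range n, Real.log (i + 2 : ℕ) *
      (Real.log (Real.log (i + 3 : ℕ)) - Real.log (Real.log (i + 2 : ℕ))) := by
    rw [← Finset.sum_sub_distrib]
    refine Finset.sum_le_sum fun i _ => ?_
    rw [hcast]
    exact (log_mul_log_log_succ_sub_bounds (by omega)).2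
  have h3 : ∑ i ∈ Finset.range n, 1 / ((i + 2 : ℕ) : ℝ) ^ 2 ≤
      ∑' n : ℕ, 1 / ((n + 2 : ℕ) : ℝ) ^ 2 := hsum.sum_le_tsum _ fun _ _ => by positivity
  have h4 : 0 ≤ Real.log 2 := Real.log_nonneg (by norm_num)
  have h5 : 0 ≤ ∑' n : ℕ, 1 / ((n + 2 : ℕ) : ℝ) ^ 2 := tsum_nonneg fun _ => by positivity
  rw [abs_le]
  constructor <;> linarith

lemma sum_range_add_two_of_eq_zero {f : ℕ → ℝ} (h0 : f 0 = 0) (h1 : f 1 = 0) (n : ℕ) :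
    ∑ i ∈ Finset.range n, f (i + 2) = ∑ i ∈ Finset.range (n + 2), f i := by
  rw [Finset.sum_range_succ', Finset.sum_range_succ', h0, h1]
  simp

lemma eulerWeight_zero : eulerWeight 0 = 0 := by simp [eulerWeight, Nat.not_prime_zero]

lemma eulerWeight_one : eulerWeight 1 = 0 := by simp [eulerWeight, Nat.not_prime_one]

lemma tendsto_eulerWeight : Tendsto eulerWeight atTop (𝓝 0) := by
  refine squeeze_zero eulerWeight_nonneg eulerWeight_le ?_
  simpa using (tendsto_inv_atTop_nhds_zero_nat (𝕜 := ℝ)).const_mul 2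

/-- The sum of `-log (1 - 1/p)` over primes `p ≤ N`, minus `log (log N)`, converges. -/
lemma exists_tendsto_sum_eulerWeight_sub_log_log :
    ∃ L : ℝ, Tendsto (fun N : ℕ => ∑ n ∈ Finset.range (N + 1), eulerWeight n -
      Real.log (Real.log N)) atTop (𝓝 L) := by
  obtain ⟨C, hC⟩ := exists_abs_sum_eulerWeight_mul_log_sub_log_le
  obtain ⟨C', hC'⟩ := exists_abs_sum_log_mul_log_log_sub_le
  set b : ℕ → ℝ := fun i => Real.log (i + 2 : ℕ) *
      (Real.log (Real.log (i + 3 : ℕ)) - Real.log (Real.log (i + 2 : ℕ))) with hb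
  have hlogpos (i : ℕ) : 0 < Real.log (i + 2 : ℕ) :=
    Real.log_pos (by push_cast; linarith [(Nat.cast_nonneg i : (0 : ℝ) ≤ i)])
  have hanti : Antitone fun i : ℕ => (Real.log (i + 2 : ℕ))⁻¹ := by
    intro i j hij
    refine inv_anti₀ (hlogpos i) (Real.log_le_log (by positivity) ?_)
    exact_mod_cast Nat.add_le_add_right hij 2
  have hzero : Tendsto (fun i : ℕ => (Real.log (i + 2 : ℕ))⁻¹) atTop (𝓝 0) :=
    tendsto_inv_atTop_zero.comp (Real.tendsto_log_atTop.comp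
      (tendsto_natCast_atTop_atTop.comp (tendsto_add_atTop_nat 2)))
  have hbdd (n : ℕ) : ‖∑ i ∈ Finset.range n,
      (eulerWeight (i + 2) * Real.log (i + 2 : ℕ) - b i)‖ ≤ C + C' + Real.log 2 := by
    rw [Finset.sum_sub_distrib,
      sum_range_add_two_of_eq_zero (f := fun i => eulerWeight i * Real.log (i : ℝ)) (by simp)
        (by simp) n, Real.norm_eq_abs]
    have h1 := hC (n + 1) (by omega)
    have h2 := hC' n
    have h3 : Real.log (n + 2 : ℕ) - Real.log (n + 1 : ℕ) ≤ Real.log 2 := by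
      rw [sub_le_iff_le_add, ← Real.log_mul (by norm_num) (by positivity)]
      refine Real.log_le_log (by positivity) ?_
      push_cast; linarith [(Nat.cast_nonneg n : (0 : ℝ) ≤ n)]
    have h4 : Real.log (n + 1 : ℕ) ≤ Real.log (n + 2 : ℕ) :=
      Real.log_le_log (by positivity) (by push_cast; linarith)
    rw [abs_le] at h1 h2 ⊢
    constructor <;> linarith
  obtain ⟨L, hL⟩ := cauchySeq_tendsto_of_complete
    (hanti.cauchySeq_series_mul_of_tendsto_zero_of_bounded hzero hbdd)
  have heq (n : ℕ) : ∑ i ∈ Finset.range n, (Real.log (i + 2 : ℕ))⁻¹ •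
      (eulerWeight (i + 2) * Real.log (i + 2 : ℕ) - b i) =
      ∑ i ∈ Finset.range (n + 2), eulerWeight i -
        (Real.log (Real.log (n + 2 : ℕ)) - Real.log (Real.log 2)) := by
    have htel := Finset.sum_range_sub (fun i : ℕ => Real.log (Real.log (i + 2 : ℕ))) n
    simp only [zero_add, Nat.cast_ofNat] at htel
    rw [← htel, ← sum_range_add_two_of_eq_zero eulerWeight_zero eulerWeight_one,
      ← Finset.sum_sub_distrib]
    refine Finset.sum_congr rfl fun i _ => ?_
    have := (hlogpos i).ne'
    rw [smul_eq_mul, hb, show i + 1 + 2 = i + 3 by ring]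
    field_simp
  simp only [heq] at hL
  refine ⟨L - Real.log (Real.log 2), ?_⟩
  rw [← tendsto_add_atTop_iff_nat 2]
  have hw := tendsto_eulerWeight.comp (tendsto_add_atTop_nat 2)
  have := (hL.sub_const (Real.log (Real.log 2))).add hw
  rw [add_zero] at this
  refine this.congr fun n => ?_
  simp only [Function.comp_apply]
  rw [Finset.sum_range_succ _ (n + 2)]
  ring

/-- The logarithm of the Euler factor of `ζ(1 + s)` at a prime `n`, and `0` elsewhere. -/
noncomputable def zetaLogWeight (s : ℝ) (n : ℕ) : ℝ :=
  if n.Prime then -Real.log (1 - (n : ℝ) ^ (-(1 + s))) else 0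

lemma natCast_rpow_neg_le_one {n : ℕ} {s : ℝ} (hs : 0 ≤ s) (hn : 1 ≤ n) :
    (n : ℝ) ^ (-s) ≤ 1 :=
  Real.rpow_le_one_of_one_le_of_nonpos (by exact_mod_cast hn) (by linarith)

lemma natCast_rpow_neg_one_add {n : ℕ} (hn : 1 ≤ n) (s : ℝ) :
    (n : ℝ) ^ (-(1 + s)) = (n : ℝ)⁻¹ * (n : ℝ) ^ (-s) := by
  have : (0 : ℝ) < n := by exact_mod_cast hn
  rw [neg_add, Real.rpow_add this, Real.rpow_neg_one]

lemma rpow_neg_one_add_le_half {n : ℕ} (hn : 2 ≤ n) {s : ℝ} (hs : 0 ≤ s) :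
    (n : ℝ) ^ (-(1 + s)) ≤ 1 / 2 := by
  rw [natCast_rpow_neg_one_add (by omega)]
  have h1 := inv_natCast_le_half hn
  have h2 := natCast_rpow_neg_le_one hs (by omega : 1 ≤ n)
  have h3 : 0 ≤ (n : ℝ)⁻¹ := by positivity
  nlinarith

lemma summable_rpow_neg_one_add {s : ℝ} (hs : 0 < s) :
    Summable fun n : ℕ => (n : ℝ) ^ (-(1 + s)) :=
  Real.summable_nat_rpow.2 (by linarith)

lemma zetaLogWeight_nonneg {s : ℝ} (hs : 0 ≤ s) (n : ℕ) : 0 ≤ zetaLogWeight s n := by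
  unfold zetaLogWeight
  split_ifs with h
  · have := rpow_neg_one_add_le_half h.two_le hs
    exact le_trans (by positivity)
      (inv_le_neg_log_one_sub (u := (n : ℝ) ^ (-(1 + s))) (by linarith))
  · rfl

lemma zetaLogWeight_le {s : ℝ} (hs : 0 ≤ s) (n : ℕ) :
    zetaLogWeight s n ≤ 2 * (n : ℝ) ^ (-(1 + s)) := by
  have h0 : 0 ≤ (n : ℝ) ^ (-(1 + s)) := by positivity
  unfold zetaLogWeight
  split_ifs with h
  · have h1 := rpow_neg_one_add_le_half h.two_le hs
    have := neg_log_one_sub_le_add_sq h1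
    nlinarith
  · linarith

lemma summable_zetaLogWeight {s : ℝ} (hs : 0 < s) : Summable (zetaLogWeight s) :=
  Summable.of_nonneg_of_le (zetaLogWeight_nonneg hs.le) (zetaLogWeight_le hs.le)
    ((summable_rpow_neg_one_add hs).mul_left 2)

lemma exp_tsum_zetaLogWeight {s : ℝ} (hs : 0 < s) :
    Real.exp (∑' n, zetaLogWeight s n) = ∑' n : ℕ, 1 / (n : ℝ) ^ (1 + s) := by
  let f : ℕ →*₀ ℝ :=
    { toFun := fun n => (n : ℝ) ^ (-(1 + s))
      map_zero' := by rw [Nat.cast_zero, Real.zero_rpow (by linarith)]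
      map_one' := by simp
      map_mul' := fun m n => by
        rw [Nat.cast_mul, Real.mul_rpow (by positivity) (by positivity)] }
  have hf (n : ℕ) : f n = (n : ℝ) ^ (-(1 + s)) := rfl
  have hsum : Summable fun n => ‖f n‖ := by
    refine (summable_rpow_neg_one_add hs).congr fun n => ?_
    rw [hf, Real.norm_of_nonneg (by positivity)]
  have hprod := EulerProduct.eulerProduct_completely_multiplicative_hasProd hsum
  have hw (p : Nat.Primes) : Real.log (1 - f p)⁻¹ = zetaLogWeight s p := by
    rw [Real.log_inv, zetaLogWeight, if_pos p.2, hf]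
  have hpos (p : Nat.Primes) : 0 < (1 - f p)⁻¹ := by
    have := rpow_neg_one_add_le_half p.2.two_le hs.le
    rw [inv_pos, hf]
    linarith
  have hsum' : Summable fun p : Nat.Primes => Real.log (1 - f p)⁻¹ := by
    simp only [hw]
    exact (summable_zetaLogWeight hs).comp_injective Subtype.val_injective
  have h := Real.rexp_tsum_eq_tprod hpos hsum'
  rw [hprod.tprod_eq] at h
  have e1 : ∑' n, zetaLogWeight s n = ∑' p : Nat.Primes, Real.log (1 - f p)⁻¹ := by
    simp only [hw]
    refine (tsum_subtype_eq_of_support_subset (s := {p | Nat.Prime p}) fun n hn => ?_).symm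
    by_contra hc
    exact hn (if_neg hc)
  rw [e1, h]
  exact tsum_congr fun n => by rw [hf, Real.rpow_neg (by positivity), one_div]

lemma tendsto_tsum_zetaLogWeight_add_log :
    Tendsto (fun s : ℝ => ∑' n, zetaLogWeight s n + Real.log s) (𝓝[>] 0) (𝓝 0) := by
  have hshift : Tendsto (fun s : ℝ => 1 + s) (𝓝[>] 0) (𝓝[>] 1) := by
    refine tendsto_nhdsWithin_of_tendsto_nhds_of_eventually_within _ ?_ ?_
    · have : Tendsto (fun s : ℝ => 1 + s) (𝓝 0) (𝓝 (1 + 0)) :=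
        tendsto_const_nhds.add tendsto_id
      rw [add_zero] at this
      exact this.mono_left nhdsWithin_le_nhds
    · filter_upwards [self_mem_nhdsWithin] with s hs
      simpa using hs
  have h := ((Real.continuousAt_log one_ne_zero).tendsto.comp
    (tendsto_sub_mul_tsum_nat_rpow.comp hshift))
  rw [Real.log_one] at h
  refine h.congr' ?_
  filter_upwards [self_mem_nhdsWithin] with s hs
  have hs : 0 < s := hs
  simp only [Function.comp_apply, add_sub_cancel_left]
  rw [← exp_tsum_zetaLogWeight hs, Real.log_mul hs.ne' (Real.exp_pos _).ne', Real.log_exp, add_comm]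

lemma abs_eulerWeight_mul_rpow_sub_zetaLogWeight_le {s : ℝ} (hs : 0 ≤ s) (n : ℕ) :
    |eulerWeight n * (n : ℝ) ^ (-s) - zetaLogWeight s n| ≤ 2 * (1 / (n : ℝ) ^ 2) := by
  unfold eulerWeight zetaLogWeight
  split_ifs with h
  · have hu := inv_natCast_le_half h.two_le
    have huy := rpow_neg_one_add_le_half h.two_le hs
    rw [natCast_rpow_neg_one_add h.one_le] at huy ⊢
    have hy1 := natCast_rpow_neg_le_one hs h.one_le
    have hy0 : 0 ≤ (n : ℝ) ^ (-s) := by positivity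
    have hu0 : 0 ≤ (n : ℝ)⁻¹ := by positivity
    rw [← one_div_pow, one_div]
    set u := (n : ℝ)⁻¹
    set y := (n : ℝ) ^ (-s)
    have a1 := inv_le_neg_log_one_sub (u := u) (by linarith)
    have a2 := neg_log_one_sub_le_add_sq hu
    have a3 := inv_le_neg_log_one_sub (u := u * y) (by linarith)
    have a4 := neg_log_one_sub_le_add_sq huy
    have a5 : (u * y) ^ 2 ≤ u ^ 2 := pow_le_pow_left₀ (by positivity) (by nlinarith) 2
    have a6 := mul_le_mul_of_nonneg_right a1 hy0
    have a7 := mul_le_mul_of_nonneg_right a2 hy0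
    have a8 : u ^ 2 * y ≤ u ^ 2 := mul_le_of_le_one_right (by positivity) hy1
    rw [abs_le]
    constructor <;> linarith
  · simp only [zero_mul, sub_zero, abs_zero]
    positivity

lemma summable_eulerWeight_mul_rpow {s : ℝ} (hs : 0 < s) :
    Summable fun n : ℕ => eulerWeight n * (n : ℝ) ^ (-s) := by
  refine Summable.of_nonneg_of_le
    (fun n => mul_nonneg (eulerWeight_nonneg n) (by positivity)) (fun n => ?_)
    ((summable_rpow_neg_one_add hs).mul_left 2)
  rcases Nat.eq_zero_or_pos n with rfl | hn
  · rw [eulerWeight_zero, zero_mul]; positivity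
  · rw [natCast_rpow_neg_one_add hn, ← mul_assoc]
    exact mul_le_mul_of_nonneg_right (eulerWeight_le n) (by positivity)

lemma tendsto_tsum_eulerWeight_add_log :
    Tendsto (fun s : ℝ => ∑' n : ℕ, eulerWeight n * (n : ℝ) ^ (-s) + Real.log s)
      (𝓝[>] 0) (𝓝 0) := by
  have hdom : Tendsto (fun s : ℝ => ∑' n : ℕ,
      (eulerWeight n * (n : ℝ) ^ (-s) - zetaLogWeight s n)) (𝓝[>] 0) (𝓝 (∑' _ : ℕ, (0 : ℝ))) := by
    refine tendsto_tsum_of_dominated_convergence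
      (bound := fun n : ℕ => 2 * (1 / (n : ℝ) ^ 2))
      ((Real.summable_one_div_nat_pow.2 one_lt_two).mul_left 2) (fun n => ?_) ?_
    · by_cases h : n.Prime
      · have hn0 : (n : ℝ) ≠ 0 := by exact_mod_cast h.ne_zero
        have hn1 : 1 - (n : ℝ)⁻¹ ≠ 0 := by
          have := inv_natCast_le_half h.two_le
          linarith
        simp only [eulerWeight, zetaLogWeight, if_pos h]
        have c1 : Tendsto (fun s : ℝ => (n : ℝ) ^ (-s)) (𝓝[>] 0) (𝓝 1) := by
          have : Tendsto (fun s : ℝ => (n : ℝ) ^ (-s)) (𝓝 0) (𝓝 ((n : ℝ) ^ (-(0 : ℝ)))) :=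
            (Real.continuousAt_const_rpow hn0).tendsto.comp (continuous_neg.tendsto 0)
          rw [neg_zero, Real.rpow_zero] at this
          exact this.mono_left nhdsWithin_le_nhds
        simp only [natCast_rpow_neg_one_add h.one_le]
        have c2 : Tendsto (fun s : ℝ => 1 - (n : ℝ)⁻¹ * (n : ℝ) ^ (-s)) (𝓝[>] 0)
            (𝓝 (1 - (n : ℝ)⁻¹)) := by
          simpa using (c1.const_mul (n : ℝ)⁻¹).const_sub 1
        have c3 := ((Real.continuousAt_log hn1).tendsto.comp c2).neg
        simpa using (c1.const_mul (-Real.log (1 - (n : ℝ)⁻¹))).sub c3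
      · simp [eulerWeight, zetaLogWeight, h]
    · filter_upwards [self_mem_nhdsWithin] with s hs n
      exact abs_eulerWeight_mul_rpow_sub_zetaLogWeight_le (le_of_lt hs) n
  rw [tsum_zero] at hdom
  have h := hdom.add tendsto_tsum_zetaLogWeight_add_log
  rw [add_zero] at h
  refine h.congr' ?_
  filter_upwards [self_mem_nhdsWithin] with s hs
  rw [(summable_eulerWeight_mul_rpow hs).tsum_sub (summable_zetaLogWeight hs)]
  ring

/-- The sum of the Euler weights of the integers `n` with `⌈log n⌉ = m`. -/
noncomputable def eulerBlock (m : ℕ) : ℝ :=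
  ∑ n ∈ (Finset.range (⌊Real.exp m⌋₊ + 1)).filter (fun n : ℕ => ⌈Real.log n⌉₊ = m), eulerWeight n

lemma ceil_log_le_iff {n m : ℕ} : ⌈Real.log n⌉₊ ≤ m ↔ n ∈ Finset.range (⌊Real.exp m⌋₊ + 1) := by
  rw [Finset.mem_range, Nat.lt_succ_iff, Nat.ceil_le, Nat.le_floor_iff (Real.exp_pos _).le]
  rcases Nat.eq_zero_or_pos n with rfl | hn
  · simp [(Real.exp_pos _).le]
  · exact Real.log_le_iff_le_exp (by exact_mod_cast hn)

lemma filter_ceil_log_eq {m k : ℕ} (hmk : m ≤ k) :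
    (Finset.range (⌊Real.exp k⌋₊ + 1)).filter (fun n : ℕ => ⌈Real.log n⌉₊ = m) =
    (Finset.range (⌊Real.exp m⌋₊ + 1)).filter (fun n : ℕ => ⌈Real.log n⌉₊ = m) := by
  ext n
  simp only [Finset.mem_filter, ← ceil_log_le_iff]
  constructor <;> rintro ⟨_, h⟩ <;> exact ⟨by omega, h⟩

lemma sum_eulerBlock (k : ℕ) :
    ∑ m ∈ Finset.range (k + 1), eulerBlock m =
      ∑ n ∈ Finset.range (⌊Real.exp k⌋₊ + 1), eulerWeight n := by
  rw [← Finset.sum_fiberwise_of_maps_to (t := Finset.range (k + 1))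
    (g := fun n : ℕ => ⌈Real.log n⌉₊)
    (fun n hn => Finset.mem_range.2 (Nat.lt_succ_of_le (ceil_log_le_iff.2 hn)))]
  refine Finset.sum_congr rfl fun m hm => ?_
  rw [filter_ceil_log_eq (Nat.lt_succ_iff.1 (Finset.mem_range.1 hm)), eulerBlock]

lemma exp_neg_mul_ceil_log_bounds {s : ℝ} (hs : 0 ≤ s) {n : ℕ} (hn : 1 ≤ n) :
    Real.exp (-s) ^ ⌈Real.log n⌉₊ ≤ (n : ℝ) ^ (-s) ∧
      Real.exp (-s) * (n : ℝ) ^ (-s) ≤ Real.exp (-s) ^ ⌈Real.log n⌉₊ := by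
  have hn0 : (0 : ℝ) < n := by exact_mod_cast hn
  have h1 := Nat.le_ceil (Real.log n)
  have h2 := Nat.ceil_lt_add_one (Real.log_natCast_nonneg n)
  rw [← Real.exp_nat_mul, Real.rpow_def_of_pos hn0, ← Real.exp_add, Real.exp_le_exp,
    Real.exp_le_exp]
  constructor <;> nlinarith

lemma summable_eulerWeight_mul_pow_ceil {s : ℝ} (hs : 0 < s) :
    Summable fun n : ℕ => eulerWeight n * Real.exp (-s) ^ ⌈Real.log n⌉₊ := by
  refine Summable.of_nonneg_of_le
    (fun n => mul_nonneg (eulerWeight_nonneg n) (by positivity)) (fun n => ?_)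
    (summable_eulerWeight_mul_rpow hs)
  rcases Nat.eq_zero_or_pos n with rfl | hn
  · simp [eulerWeight_zero]
  · exact mul_le_mul_of_nonneg_left (exp_neg_mul_ceil_log_bounds hs.le hn).1 (eulerWeight_nonneg n)

lemma hasSum_eulerBlock_mul_pow {s : ℝ} (hs : 0 < s) :
    HasSum (fun m : ℕ => eulerBlock m * Real.exp (-s) ^ m)
      (∑' n : ℕ, eulerWeight n * Real.exp (-s) ^ ⌈Real.log n⌉₊) := by
  have h := (summable_eulerWeight_mul_pow_ceil hs).hasSum.tsum_fiberwise
    (fun n : ℕ => ⌈Real.log n⌉₊)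
  convert! h using 2 with m
  have hfib : (fun n : ℕ => ⌈Real.log n⌉₊) ⁻¹' {m} =
      ((Finset.range (⌊Real.exp m⌋₊ + 1)).filter (fun n : ℕ => ⌈Real.log n⌉₊ = m) : Finset ℕ) := by
    ext n
    simp only [Set.mem_preimage, Set.mem_singleton_iff, Finset.mem_coe, Finset.mem_filter,
      ← ceil_log_le_iff]
    exact ⟨fun h => ⟨h.le, h⟩, fun h => h.2⟩
  rw [hfib]
  rw [Finset.tsum_subtype' _ (fun n : ℕ => eulerWeight n * Real.exp (-s) ^ ⌈Real.log n⌉₊),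
    eulerBlock, Finset.sum_mul]
  exact Finset.sum_congr rfl fun n hn => by rw [(Finset.mem_filter.1 hn).2]

lemma tendsto_tsum_eulerWeight_mul_pow_ceil_add_log :
    Tendsto (fun s : ℝ => ∑' n : ℕ, eulerWeight n * Real.exp (-s) ^ ⌈Real.log n⌉₊ +
      Real.log (1 - Real.exp (-s))) (𝓝[>] 0) (𝓝 0) := by
  set G : ℝ → ℝ := fun s => ∑' n : ℕ, eulerWeight n * (n : ℝ) ^ (-s) with hG
  have hG0 : Tendsto (fun s => G s + Real.log s) (𝓝[>] 0) (𝓝 0) := tendsto_tsum_eulerWeight_add_log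
  have hid : Tendsto (fun s : ℝ => s) (𝓝[>] 0) (𝓝 0) := nhdsWithin_le_nhds
  have hslog : Tendsto (fun s : ℝ => s * Real.log s) (𝓝[>] 0) (𝓝 0) := by
    have := (Real.continuous_mul_log.tendsto 0).mono_left (nhdsWithin_le_nhds (s := Set.Ioi 0))
    simpa using this
  have hsG : Tendsto (fun s : ℝ => s * G s) (𝓝[>] 0) (𝓝 0) := by
    have := (hid.mul hG0).sub hslog
    rw [mul_zero, sub_zero] at this
    exact this.congr fun s => by ring
  have hdiff : Tendsto (fun s : ℝ => G s -
      ∑' n : ℕ, eulerWeight n * Real.exp (-s) ^ ⌈Real.log n⌉₊) (𝓝[>] 0) (𝓝 0) := by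
    refine squeeze_zero' ?_ ?_ hsG
    · filter_upwards [self_mem_nhdsWithin] with s hs
      have hs : 0 < s := hs
      rw [sub_nonneg]
      refine (summable_eulerWeight_mul_pow_ceil hs).tsum_le_tsum (fun n => ?_)
        (summable_eulerWeight_mul_rpow hs)
      rcases Nat.eq_zero_or_pos n with rfl | hn
      · simp [eulerWeight_zero]
      · exact mul_le_mul_of_nonneg_left (exp_neg_mul_ceil_log_bounds hs.le hn).1
          (eulerWeight_nonneg n)
    · filter_upwards [self_mem_nhdsWithin] with s hs
      have hs : 0 < s := hs
      have h1 : Real.exp (-s) * G s ≤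
          ∑' n : ℕ, eulerWeight n * Real.exp (-s) ^ ⌈Real.log n⌉₊ := by
        rw [hG, ← tsum_mul_left]
        refine ((summable_eulerWeight_mul_rpow hs).mul_left _).tsum_le_tsum (fun n => ?_)
          (summable_eulerWeight_mul_pow_ceil hs)
        rcases Nat.eq_zero_or_pos n with rfl | hn
        · simp [eulerWeight_zero]
        · rw [mul_left_comm]
          exact mul_le_mul_of_nonneg_left (exp_neg_mul_ceil_log_bounds hs.le hn).2
            (eulerWeight_nonneg n)
      have h2 : 0 ≤ G s :=
        tsum_nonneg fun n => mul_nonneg (eulerWeight_nonneg n) (by positivity)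
      have h3 := Real.add_one_le_exp (-s)
      nlinarith
  have hlog : Tendsto (fun s : ℝ => Real.log ((1 - Real.exp (-s)) / s)) (𝓝[>] 0) (𝓝 0) := by
    have hd : HasDerivAt (fun s : ℝ => 1 - Real.exp (-s)) 1 0 := by
      have := ((hasDerivAt_neg (0 : ℝ)).exp).const_sub 1
      simpa using this
    have hslope := hd.tendsto_slope.mono_left (nhdsWithin_mono 0 (fun s (hs : 0 < s) => hs.ne'))
    have := (Real.continuousAt_log one_ne_zero).tendsto.comp hslope
    rw [Real.log_one] at this
    refine this.congr fun s => ?_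
    simp [slope_def_field]
  have h := (hG0.sub hdiff).add hlog
  rw [sub_zero, add_zero] at h
  refine h.congr' ?_
  filter_upwards [self_mem_nhdsWithin] with s hs
  have hs : 0 < s := hs
  have : Real.exp (-s) < 1 := Real.exp_lt_one_iff.2 (by linarith)
  rw [Real.log_div (by linarith) hs.ne']
  ring

lemma sum_range_inv_eq_harmonic (n : ℕ) :
    ∑ m ∈ Finset.range (n + 1), (m : ℝ)⁻¹ = (harmonic n : ℝ) := by
  rw [Finset.sum_range_succ', harmonic]
  push_cast
  simp

lemma hasSum_inv_mul_pow {x : ℝ} (hx : |x| < 1) :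
    HasSum (fun m : ℕ => (m : ℝ)⁻¹ * x ^ m) (-Real.log (1 - x)) := by
  rw [← hasSum_nat_add_iff' 1]
  simp only [Finset.range_one, Finset.sum_singleton, Nat.cast_zero, inv_zero, zero_mul, sub_zero]
  convert! Real.hasSum_pow_div_log_of_abs_lt_one hx using 2 with m
  rw [div_eq_inv_mul]
  push_cast
  rfl

lemma tendsto_log_floor_exp_div :
    Tendsto (fun k : ℕ => Real.log (Real.log ⌊Real.exp k⌋₊) - Real.log k) atTop (𝓝 0) := by
  have h1 : Tendsto (fun k : ℕ => (⌊Real.exp k⌋₊ : ℝ) / Real.exp k) atTop (𝓝 1) :=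
    (tendsto_nat_floor_div_atTop (R := ℝ)).comp
      (Real.tendsto_exp_atTop.comp tendsto_natCast_atTop_atTop)
  have h2 := (Real.continuousAt_log one_ne_zero).tendsto.comp h1
  have h3 := (h2.mul (tendsto_inv_atTop_nhds_zero_nat (𝕜 := ℝ))).const_add 1
  rw [Real.log_one, zero_mul, add_zero] at h3
  have h4 := (Real.continuousAt_log one_ne_zero).tendsto.comp h3
  rw [Real.log_one] at h4
  refine h4.congr' ?_
  filter_upwards [eventually_ge_atTop 1] with k hk
  have hk0 : (1 : ℝ) ≤ k := by exact_mod_cast hk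
  have hfl : 2 ≤ ⌊Real.exp k⌋₊ := by
    rw [Nat.le_floor_iff (Real.exp_pos _).le]
    push_cast
    linarith [Real.add_one_le_exp (k : ℝ)]
  have hfl' : (2 : ℝ) ≤ ⌊Real.exp k⌋₊ := by exact_mod_cast hfl
  have hlog : 0 < Real.log ⌊Real.exp k⌋₊ := Real.log_pos (by linarith)
  simp only [Function.comp_apply]
  rw [Real.log_div (by linarith) (Real.exp_pos _).ne', Real.log_exp,
    ← Real.log_div hlog.ne' (by linarith)]
  congr 1
  field_simp
  ring

/-- The sum of `-log (1 - 1/p)` over primes `p ≤ N` is `log (log N) + γ + o(1)`. -/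
theorem tendsto_sum_eulerWeight_sub_log_log :
    Tendsto (fun N : ℕ => ∑ n ∈ Finset.range (N + 1), eulerWeight n - Real.log (Real.log N))
      atTop (𝓝 Real.eulerMascheroniConstant) := by
  obtain ⟨L, hL⟩ := exists_tendsto_sum_eulerWeight_sub_log_log
  have hfloor : Tendsto (fun k : ℕ => ⌊Real.exp k⌋₊) atTop atTop :=
    tendsto_nat_floor_atTop.comp (Real.tendsto_exp_atTop.comp tendsto_natCast_atTop_atTop)
  have hpartial : Tendsto (fun k => ∑ m ∈ Finset.range k, (eulerBlock m - (m : ℝ)⁻¹)) atTop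
      (𝓝 (L - Real.eulerMascheroniConstant)) := by
    rw [← tendsto_add_atTop_iff_nat 1]
    have h := ((hL.comp hfloor).add tendsto_log_floor_exp_div).sub Real.tendsto_harmonic_sub_log
    rw [add_zero] at h
    refine h.congr fun k => ?_
    rw [Finset.sum_sub_distrib, sum_eulerBlock, sum_range_inv_eq_harmonic]
    simp only [Function.comp_apply]
    ring
  have hexp : Tendsto (fun s : ℝ => Real.exp (-s)) (𝓝[>] 0) (𝓝[<] 1) := by
    refine tendsto_nhdsWithin_of_tendsto_nhds_of_eventually_within _ ?_ ?_
    · have : Tendsto (fun s : ℝ => Real.exp (-s)) (𝓝 0) (𝓝 (Real.exp (-0))) :=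
        (Real.continuous_exp.comp continuous_neg).tendsto 0
      rw [neg_zero, Real.exp_zero] at this
      exact this.mono_left nhdsWithin_le_nhds
    · filter_upwards [self_mem_nhdsWithin] with s hs
      have hs : 0 < s := hs
      exact Real.exp_lt_one_iff.2 (by linarith)
  have habel := (Real.tendsto_tsum_powerSeries_nhdsWithin_lt hpartial).comp hexp
  have hzero : L - Real.eulerMascheroniConstant = 0 := by
    refine tendsto_nhds_unique habel (tendsto_tsum_eulerWeight_mul_pow_ceil_add_log.congr' ?_)
    filter_upwards [self_mem_nhdsWithin] with s hs
    have hs : 0 < s := hs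
    have hx : |Real.exp (-s)| < 1 := by
      rw [abs_of_pos (Real.exp_pos _)]
      exact Real.exp_lt_one_iff.2 (by linarith)
    have h := (hasSum_eulerBlock_mul_pow hs).sub (hasSum_inv_mul_pow hx)
    simp only [Function.comp_apply, sub_mul]
    rw [h.tsum_eq]
    ring
  rwa [sub_eq_zero.1 hzero] at hL

lemma prod_primesUpTo_eq_exp (x : ℝ) :
    ∏ p ∈ primesUpTo x, (1 - (p : ℝ)⁻¹) =
      Real.exp (-∑ n ∈ Finset.range (⌊x⌋₊ + 1), eulerWeight n) := by
  have h : ∑ n ∈ Finset.range (⌊x⌋₊ + 1), eulerWeight n =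
      ∑ p ∈ primesUpTo x, -Real.log (1 - (p : ℝ)⁻¹) := by
    rw [primesUpTo, Finset.sum_filter, Nat.range_succ_eq_Iic]
    rfl
  rw [h, ← Finset.sum_neg_distrib, Real.exp_sum]
  refine Finset.prod_congr rfl fun p hp => ?_
  have := inv_natCast_le_half (Finset.mem_filter.1 hp).2.two_le
  rw [neg_neg, Real.exp_log (by linarith)]

/-- Mertens' third theorem. -/
theorem tendsto_prod_primesUpTo_mul_log :
    Tendsto (fun x : ℝ => (∏ p ∈ primesUpTo x, (1 - (p : ℝ)⁻¹)) * Real.log x) atTop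
      (𝓝 (Real.exp (-Real.eulerMascheroniConstant))) := by
  have h1 := (Real.continuous_exp.tendsto _).comp
    (tendsto_sum_eulerWeight_sub_log_log.comp (tendsto_nat_floor_atTop (α := ℝ))).neg
  have h2 : Tendsto (fun x : ℝ => Real.log ⌊x⌋₊ / Real.log x) atTop (𝓝 1) := by
    have a1 := (Real.continuousAt_log one_ne_zero).tendsto.comp
      (tendsto_nat_floor_div_atTop (R := ℝ))
    have a2 := (a1.mul (tendsto_inv_atTop_zero.comp Real.tendsto_log_atTop)).const_add 1
    rw [Real.log_one, zero_mul, add_zero] at a2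
    refine a2.congr' ?_
    filter_upwards [eventually_ge_atTop 2] with x hx
    have hlog : 0 < Real.log x := Real.log_pos (by linarith)
    have hfl : (⌊x⌋₊ : ℝ) ≠ 0 := by
      have : 0 < ⌊x⌋₊ := Nat.floor_pos.2 (by linarith)
      positivity
    simp only [Function.comp_apply]
    rw [Real.log_div hfl (by linarith)]
    field_simp
    ring
  have h3 := h1.div h2 one_ne_zero
  rw [div_one] at h3
  refine h3.congr' ?_
  filter_upwards [eventually_ge_atTop 2] with x hx
  have hlog : 0 < Real.log x := Real.log_pos (by linarith)
  have hfl : (2 : ℝ) ≤ ⌊x⌋₊ := by exact_mod_cast Nat.le_floor (by exact_mod_cast hx)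
  have hlogfl : 0 < Real.log ⌊x⌋₊ := Real.log_pos (by linarith)
  rw [prod_primesUpTo_eq_exp]
  simp only [Pi.div_apply, Function.comp_apply]
  rw [neg_sub, Real.exp_sub, Real.exp_log hlogfl, Real.exp_neg]
  field_simp

/-- Residues modulo the members of a pairwise coprime finset may be prescribed independently. -/
lemma card_filter_Ioc_prod_mod_mem (s : Finset ℕ) (hpos : ∀ p ∈ s, 0 < p)
    (hco : (s : Set ℕ).Pairwise Nat.Coprime) (R : ℕ → Finset ℕ) (hR : ∀ p ∈ s, ∀ r ∈ R p, r < p) :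
    ((Finset.Ioc 0 (∏ p ∈ s, p)).filter (fun n => ∀ p ∈ s, n % p ∈ R p)).card =
      ∏ p ∈ s, (R p).card := by
  have hM : 0 < ∏ p ∈ s, p := Finset.prod_pos hpos
  rw [← Finset.card_pi]
  refine Finset.card_bij (fun n _ p _ => n % p) ?_ ?_ ?_
  · intro n hn
    exact Finset.mem_pi.2 (Finset.mem_filter.1 hn).2
  · intro m hm n hn h
    have hmod : m ≡ n [MOD ∏ p ∈ s, p] := by
      rw [Nat.modEq_iff_dvd, Nat.cast_prod]
      refine Finset.prod_dvd_of_coprime (fun p hp q hq hpq => ?_) fun p hp => ?_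
      · exact Nat.isCoprime_iff_coprime.2 (hco hp hq hpq)
      · exact Nat.modEq_iff_dvd.1 (congrFun (congrFun h p) hp)
    have hm := Finset.mem_Ioc.1 (Finset.mem_filter.1 hm).1
    have hn := Finset.mem_Ioc.1 (Finset.mem_filter.1 hn).1
    rw [Nat.modEq_iff_dvd] at hmod
    have := Int.eq_zero_of_abs_lt_dvd hmod (by rw [abs_lt]; constructor <;> omega)
    omega
  · intro a ha
    rw [Finset.mem_pi] at ha
    have hne : ∀ p ∈ s, id p ≠ 0 := fun p hp => (hpos p hp).ne'
    have hco' : Set.Pairwise (s : Set ℕ) (Function.onFun Nat.Coprime id) := hco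
    let a' : ℕ → ℕ := fun p => if hp : p ∈ s then a p hp else 0
    obtain ⟨k, hk⟩ : ∃ k, (∀ p ∈ s, k ≡ a' p [MOD p]) ∧ k < ∏ p ∈ s, p :=
      ⟨Nat.chineseRemainderOfFinset a' id s hne hco',
        (Nat.chineseRemainderOfFinset a' id s hne hco').2,
        Nat.chineseRemainderOfFinset_lt_prod a' id hne hco'⟩
    obtain ⟨n, hn0, hnM, hn⟩ : ∃ n, 0 < n ∧ n ≤ ∏ p ∈ s, p ∧ ∀ p ∈ s, n % p = a' p := by
      have key : ∀ p ∈ s, k % p = a' p := fun p hp => by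
        have h := hk.1 p hp
        rw [Nat.ModEq, Nat.mod_eq_of_lt (a := a' p)] at h
        · exact h
        · simp only [a', dif_pos hp]
          exact hR p hp _ (ha p hp)
      rcases Nat.eq_zero_or_pos k with rfl | hk0
      · refine ⟨_, hM, le_rfl, fun p hp => ?_⟩
        rw [← key p hp, Nat.zero_mod]
        exact Nat.mod_eq_zero_of_dvd (Finset.dvd_prod_of_mem _ hp)
      · exact ⟨k, hk0, hk.2.le, key⟩
    refine ⟨n, Finset.mem_filter.2 ⟨Finset.mem_Ioc.2 ⟨hn0, hnM⟩, fun p hp => ?_⟩, ?_⟩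
    · rw [hn p hp]
      simp only [a', dif_pos hp]
      exact ha p hp
    · funext p hp
      rw [hn p hp]
      simp only [a', dif_pos hp]

open scoped Classical in
/-- The residues in `[0, p)` congruent to a power of `g` modulo `p`. -/
noncomputable def powerResidues (g : ℤ) (p : ℕ) : Finset ℕ :=
  (Finset.range p).filter fun r => ∃ k : ℕ, (r : ℤ) ≡ g ^ k [ZMOD (p : ℕ)]

lemma mem_powerResidues {g : ℤ} {p r : ℕ} :
    r ∈ powerResidues g p ↔ r < p ∧ ∃ k : ℕ, (r : ℤ) ≡ g ^ k [ZMOD (p : ℕ)] := by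
  simp [powerResidues]

lemma mod_mem_powerResidues {g : ℤ} {p n : ℕ} (hp : 0 < p) :
    n % p ∈ powerResidues g p ↔ ∃ k : ℕ, (n : ℤ) ≡ g ^ k [ZMOD (p : ℕ)] := by
  rw [mem_powerResidues, and_iff_right (Nat.mod_lt _ hp)]
  simp [Int.ModEq]

lemma card_powerResidues_of_dvd {g : ℤ} {p : ℕ} (hp : p.Prime) (h : (p : ℤ) ∣ g) :
    (powerResidues g p).card = 2 := by
  have : powerResidues g p = {0, 1} := by
    ext r
    rw [mem_powerResidues, Finset.mem_insert, Finset.mem_singleton]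
    constructor
    · rintro ⟨hr, k, hk⟩
      rcases Nat.eq_zero_or_pos k with rfl | hk0
      · right
        have : r ≡ 1 [MOD p] := (Int.natCast_modEq_iff).1 (by simpa using hk)
        exact this.eq_of_lt_of_lt hr hp.one_lt
      · left
        have : (r : ℤ) ≡ 0 [ZMOD p] :=
          hk.trans (Int.modEq_zero_iff_dvd.2 (h.trans (dvd_pow_self g hk0.ne')))
        have : r ≡ 0 [MOD p] := (Int.natCast_modEq_iff).1 (by simpa using this)
        exact this.eq_of_lt_of_lt hr hp.pos
    · rintro (rfl | rfl)
      · exact ⟨hp.pos, 1, by simpa using (Int.modEq_zero_iff_dvd.2 h).symm⟩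
      · exact ⟨hp.one_lt, 0, by simp⟩
  rw [this]
  rfl

lemma orderOf_intCast_dvd_sub_one {g : ℤ} {p : ℕ} (hp : p.Prime) (h : ¬ (p : ℤ) ∣ g) :
    orderOf (g : ZMod p) ∣ p - 1 := by
  have := Fact.mk hp
  exact orderOf_dvd_of_pow_eq_one (ZMod.pow_card_sub_one_eq_one
    fun h0 => h ((ZMod.intCast_zmod_eq_zero_iff_dvd g p).1 h0))

lemma orderOf_intCast_pos {g : ℤ} {p : ℕ} (hp : p.Prime) (h : ¬ (p : ℤ) ∣ g) :
    0 < orderOf (g : ZMod p) :=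
  Nat.pos_of_dvd_of_pos (orderOf_intCast_dvd_sub_one hp h) (Nat.sub_pos_of_lt hp.one_lt)

lemma card_powerResidues_of_not_dvd {g : ℤ} {p : ℕ} (hp : p.Prime) (h : ¬ (p : ℤ) ∣ g) :
    (powerResidues g p).card = orderOf (g : ZMod p) := by
  have := Fact.mk hp
  have himg : powerResidues g p =
      (Finset.range (orderOf (g : ZMod p))).image fun k => ((g : ZMod p) ^ k).val := by
    ext r
    rw [mem_powerResidues, Finset.mem_image]
    constructor
    · rintro ⟨hr, k, hk⟩
      refine ⟨k % orderOf (g : ZMod p),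
        Finset.mem_range.2 (Nat.mod_lt _ (orderOf_intCast_pos hp h)), ?_⟩
      rw [pow_mod_orderOf]
      have := (ZMod.intCast_eq_intCast_iff _ _ p).2 hk
      push_cast at this
      rw [← this, ZMod.val_natCast_of_lt hr]
    · rintro ⟨k, _, rfl⟩
      refine ⟨ZMod.val_lt _, k, (ZMod.intCast_eq_intCast_iff _ _ p).1 ?_⟩
      push_cast
      rw [ZMod.natCast_zmod_val]
  rw [himg, Finset.card_image_of_injOn, Finset.card_range]
  intro i hi j hj hij
  exact pow_injOn_Iio_orderOf (by simpa using hi) (by simpa using hj) (ZMod.val_injective p hij)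

lemma mem_primesUpTo {x : ℝ} (hx : 0 ≤ x) {p : ℕ} :
    p ∈ primesUpTo x ↔ p.Prime ∧ (p : ℝ) ≤ x := by
  rw [primesUpTo, Finset.mem_filter, Finset.mem_Iic, Nat.le_floor_iff hx, and_comm]

lemma prime_of_mem_primesUpTo {x : ℝ} {p : ℕ} (hp : p ∈ primesUpTo x) : p.Prime :=
  (Finset.mem_filter.1 hp).2

/-- The number of residue classes modulo `M(x)` that are powers of `g` modulo every `p ≤ x`. -/
noncomputable def powerClassCount (g : ℤ) (x : ℝ) : ℕ :=
  ∏ p ∈ primesUpTo x, (powerResidues g p).card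

lemma card_powerResidues_pos (g : ℤ) {p : ℕ} (hp : p.Prime) : 0 < (powerResidues g p).card :=
  Finset.card_pos.2 ⟨1, mem_powerResidues.2 ⟨hp.one_lt, 0, by simp⟩⟩

lemma powerClassCount_pos (g : ℤ) (x : ℝ) : 0 < powerClassCount g x :=
  Finset.prod_pos fun _ hp => card_powerResidues_pos g (prime_of_mem_primesUpTo hp)

lemma two_le_card_powerResidues {g : ℤ} {p : ℕ} (hp : p.Prime) (h : ¬ (p : ℤ) ∣ g - 1) :
    2 ≤ (powerResidues g p).card := by
  by_cases hg : (p : ℤ) ∣ g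
  · rw [card_powerResidues_of_dvd hp hg]
  · rw [card_powerResidues_of_not_dvd hp hg]
    have h0 := orderOf_intCast_pos hp hg
    have h1 : orderOf (g : ZMod p) ≠ 1 := by
      rw [Ne, orderOf_eq_one_iff]
      intro h1
      refine h ((ZMod.intCast_zmod_eq_zero_iff_dvd (g - 1) p).1 ?_)
      push_cast
      rw [h1, sub_self]
    omega

lemma two_pow_primeCounting_le {g : ℤ} (hg : g ≠ 1) (x : ℝ) :
    2 ^ Nat.primeCounting ⌊x⌋₊ ≤
      powerClassCount g x * 2 ^ (g - 1).natAbs.primeFactors.card := by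
  set F := (g - 1).natAbs.primeFactors
  have hcard : (primesUpTo x).card = Nat.primeCounting ⌊x⌋₊ := by
    rw [← Nat.primesLE_card_eq_primeCounting, Nat.primesLE_eq_filter_range,
      Nat.range_succ_eq_Iic, primesUpTo]
  have h1 : 2 ^ (primesUpTo x \ F).card ≤ powerClassCount g x := by
    refine le_trans ?_ (Finset.prod_le_prod_of_subset_of_one_le'
      (f := fun p => (powerResidues g p).card)
      (Finset.sdiff_subset (s := primesUpTo x) (t := F))
      fun p hp _ => card_powerResidues_pos g (prime_of_mem_primesUpTo hp))
    refine Finset.pow_card_le_prod _ _ _ fun p hp => ?_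
    rw [Finset.mem_sdiff] at hp
    have hpp := prime_of_mem_primesUpTo hp.1
    refine two_le_card_powerResidues hpp fun hd => hp.2 ?_
    rw [Nat.mem_primeFactors]
    exact ⟨hpp, Int.natCast_dvd.1 hd, by simpa [sub_eq_zero] using hg⟩
  calc 2 ^ Nat.primeCounting ⌊x⌋₊ ≤ 2 ^ ((primesUpTo x \ F).card + F.card) := by
        refine Nat.pow_le_pow_right two_pos ?_
        have := Finset.card_le_card_sdiff_add_card (s := primesUpTo x) (t := F)
        omega
    _ ≤ _ := by rw [pow_add]; gcongr

lemma eventually_four_mul_log_le_primeCounting :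
    ∀ᶠ N : ℕ in atTop, 4 * Real.log N ≤ Nat.primeCounting N := by
  have h1 : ∀ᶠ N : ℕ in atTop, ‖Real.log (N : ℝ) ^ 2‖ ≤ 1 / 10 * ‖id (N : ℝ)‖ :=
    tendsto_natCast_atTop_atTop.eventually
      ((Real.isLittleO_pow_log_id_atTop (n := 2)).bound (by norm_num))
  have h2 : ∀ᶠ N : ℕ in atTop, 2 ≤ Real.log (N : ℝ) :=
    (Real.tendsto_log_atTop.comp tendsto_natCast_atTop_atTop).eventually_ge_atTop 2
  filter_upwards [h1, h2, eventually_ge_atTop 2] with N h1 h2 h3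
  have hN : (2 : ℝ) ≤ N := by exact_mod_cast h3
  refine le_trans ?_ (Chebyshev.pi_ge N)
  rw [le_div_iff₀ (by linarith)]
  simp only [id, Real.norm_eq_abs] at h1
  rw [abs_of_nonneg (sq_nonneg _), abs_of_nonneg (by linarith)] at h1
  have h4 : Real.log ((N : ℝ) + 1) ≤ 2 * Real.log N := by
    rw [← Real.log_rpow (by linarith)]
    refine Real.log_le_log (by linarith) ?_
    norm_num
    nlinarith
  have h5 := Real.log_two_gt_d9
  nlinarith

lemma tendsto_two_mul_add_one_div_two_pow_primeCounting :
    Tendsto (fun N : ℕ => (2 * N + 1 : ℝ) / 2 ^ Nat.primeCounting N) atTop (𝓝 0) := by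
  have hlim : Tendsto (fun N : ℕ => 3 * (N : ℝ)⁻¹) atTop (𝓝 0) := by
    simpa using (tendsto_inv_atTop_nhds_zero_nat (𝕜 := ℝ)).const_mul 3
  refine squeeze_zero' (Eventually.of_forall fun N => by positivity) ?_ hlim
  filter_upwards [eventually_four_mul_log_le_primeCounting, eventually_ge_atTop 1] with N h h1
  have hN : (1 : ℝ) ≤ N := by exact_mod_cast h1
  have hpow : (N : ℝ) ^ 2 ≤ 2 ^ Nat.primeCounting N := by
    rw [← Real.log_le_log_iff (by positivity) (by positivity), Real.log_pow, Real.log_pow]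
    have h5 := Real.log_two_gt_d9
    have h6 := Real.log_natCast_nonneg N
    push_cast
    nlinarith
  rw [← div_eq_mul_inv, div_le_div_iff₀ (by positivity) (by linarith)]
  nlinarith

lemma tendsto_two_mul_floor_add_one_div_powerClassCount {g : ℤ} (hg : g ≠ 1) :
    Tendsto (fun x : ℝ => (2 * ⌊x⌋₊ + 1 : ℝ) / powerClassCount g x) atTop (𝓝 0) := by
  set c := (g - 1).natAbs.primeFactors.card with hc
  have h := (tendsto_two_mul_add_one_div_two_pow_primeCounting.comp
    (tendsto_nat_floor_atTop (α := ℝ))).mul_const ((2 : ℝ) ^ c)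
  rw [zero_mul] at h
  refine squeeze_zero (fun x => by positivity) (fun x => ?_) h
  have h1 : (2 : ℝ) ^ Nat.primeCounting ⌊x⌋₊ ≤ powerClassCount g x * 2 ^ c := by
    exact_mod_cast two_pow_primeCounting_le hg x
  have h2 : (0 : ℝ) < powerClassCount g x := by exact_mod_cast powerClassCount_pos g x
  simp only [Function.comp_apply]
  rw [div_mul_eq_mul_div, div_le_div_iff₀ h2 (by positivity), mul_assoc]
  refine mul_le_mul_of_nonneg_left ?_ (by positivity)
  linarith

lemma card_filter_Ioc_Mx (g : ℤ) (x : ℝ) :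
    ((Finset.Ioc 0 (Mx x)).filter
      (fun n => ∀ p ∈ primesUpTo x, n % p ∈ powerResidues g p)).card = powerClassCount g x :=
  card_filter_Ioc_prod_mod_mem _ (fun _ hp => (prime_of_mem_primesUpTo hp).pos)
    (fun _ hp _ hq hpq => (Nat.coprime_primes (prime_of_mem_primesUpTo hp)
      (prime_of_mem_primesUpTo hq)).2 hpq) _
    fun _ _ _ hr => (mem_powerResidues.1 hr).1

lemma Mx_le (x : ℝ) : Mx x ≤ 2 ^ (2 * ⌊x⌋₊) := by
  rw [pow_mul]
  refine le_trans (le_of_eq ?_) (primorial_le_four_pow ⌊x⌋₊)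
  rw [Mx, primesUpTo, primorial, Nat.range_succ_eq_Iic]

lemma pseudopowersIn_bounds {g : ℤ} (hg : 2 ≤ |g|) {x : ℝ} (hx : 0 ≤ x) :
    pseudopowersIn g x 0 (Mx x) ≤ powerClassCount g x ∧
      powerClassCount g x ≤ pseudopowersIn g x 0 (Mx x) + (2 * ⌊x⌋₊ + 1) := by
  classical
  set A := (Finset.Ioc 0 (Mx x)).filter (fun n => ∀ p ∈ primesUpTo x, n % p ∈ powerResidues g p)
    with hA
  have hset : {n : ℕ | IsPseudopower g x n ∧ (0 : ℝ) < n ∧ (n : ℝ) ≤ 0 + Mx x} =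
      (A.filter fun n : ℕ => ¬ ∃ k : ℕ, (n : ℤ) = g ^ k : Finset ℕ) := by
    ext n
    simp only [Set.mem_ofPred_eq, IsPseudopower, Finset.coe_filter, hA, Finset.mem_filter,
      Finset.mem_Ioc, zero_add, Nat.cast_pos, Nat.cast_le]
    have hmod : (∀ p ∈ primesUpTo x, n % p ∈ powerResidues g p) ↔
        ∀ p : ℕ, p.Prime → (p : ℝ) ≤ x → ∃ k : ℕ, (n : ℤ) ≡ g ^ k [ZMOD (p : ℕ)] := by
      refine forall_congr' fun p => ?_
      rw [mem_primesUpTo hx, and_imp]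
      exact forall_congr' fun hp => forall_congr' fun _ => mod_mem_powerResidues hp.pos
    rw [hmod]
    tauto
  have hcount : pseudopowersIn g x 0 (Mx x) =
      (A.filter fun n : ℕ => ¬ ∃ k : ℕ, (n : ℤ) = g ^ k).card := by
    rw [pseudopowersIn, hset, Set.ncard_coe_finset]
  have hpow : (A.filter fun n : ℕ => ∃ k : ℕ, (n : ℤ) = g ^ k).card ≤ 2 * ⌊x⌋₊ + 1 := by
    have hsub : (A.filter fun n : ℕ => ∃ k : ℕ, (n : ℤ) = g ^ k) ⊆
        (Finset.range (2 * ⌊x⌋₊ + 1)).image fun k => g.natAbs ^ k := by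
      intro n hn
      obtain ⟨hnA, k, hk⟩ := Finset.mem_filter.1 hn
      have hnM := (Finset.mem_Ioc.1 (Finset.mem_filter.1 hnA).1).2
      have hn' : n = g.natAbs ^ k := by
        rw [← Int.natAbs_pow, ← hk, Int.natAbs_natCast]
      refine Finset.mem_image.2 ⟨k, Finset.mem_range.2 (Nat.lt_succ_of_le ?_), hn'.symm⟩
      refine (Nat.pow_le_pow_iff_right one_lt_two).1 ?_
      calc 2 ^ k ≤ g.natAbs ^ k := Nat.pow_le_pow_left (by zify; exact hg) k
        _ ≤ Mx x := hn' ▸ hnM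
        _ ≤ _ := Mx_le x
    exact (Finset.card_le_card hsub).trans (Finset.card_image_le.trans_eq (Finset.card_range _))
  have hsplit := Finset.card_filter_add_card_filter_not (s := A)
    (fun n : ℕ => ∃ k : ℕ, (n : ℤ) = g ^ k)
  rw [hA, card_filter_Ioc_Mx, ← hA] at hsplit
  omega

lemma totient_radical (g : ℤ) :
    Nat.totient (radical g) = ∏ p ∈ g.natAbs.primeFactors, (p - 1) := by
  have hp : ∀ p ∈ g.natAbs.primeFactors, p.Prime := fun p => Nat.prime_of_mem_primeFactors
  have h := Nat.totient_mul_prod_primeFactors (radical g)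
  rw [radical, Nat.primeFactors_prod hp] at h
  have hpos : 0 < ∏ p ∈ g.natAbs.primeFactors, p := Finset.prod_pos fun p h => (hp p h).pos
  rw [mul_comm] at h
  exact Nat.eq_of_mul_eq_mul_left hpos h

lemma filter_dvd_primesUpTo {g : ℤ} (hg : g ≠ 0) {x : ℝ} (hx : (g.natAbs : ℝ) ≤ x) :
    (primesUpTo x).filter (fun p : ℕ => (p : ℤ) ∣ g) = g.natAbs.primeFactors := by
  have hx0 : 0 ≤ x := le_trans (by positivity) hx
  ext p
  rw [Finset.mem_filter, mem_primesUpTo hx0, Nat.mem_primeFactors, Int.natCast_dvd]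
  constructor
  · rintro ⟨⟨hp, _⟩, hd⟩
    exact ⟨hp, hd, by simpa using hg⟩
  · rintro ⟨hp, hd, h0⟩
    refine ⟨⟨hp, le_trans ?_ hx⟩, hd⟩
    exact_mod_cast Nat.le_of_dvd (Nat.pos_of_ne_zero h0) hd

lemma Ig_pos (g : ℤ) (x : ℝ) : 0 < Ig g x := by
  refine Finset.prod_pos fun p hp => ?_
  obtain ⟨hp, hd⟩ := Finset.mem_filter.1 hp
  have hp := prime_of_mem_primesUpTo hp
  have h1 : 0 < p - 1 := Nat.sub_pos_of_lt hp.one_lt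
  exact Nat.div_pos (Nat.le_of_dvd h1 (orderOf_intCast_dvd_sub_one hp hd))
    (orderOf_intCast_pos hp hd)

lemma powerClassCount_mul_totient_mul_Ig {g : ℤ} (hg : g ≠ 0) {x : ℝ} (hx : (g.natAbs : ℝ) ≤ x) :
    powerClassCount g x * (Nat.totient (radical g) * Ig g x) =
      2 ^ g.natAbs.primeFactors.card * ∏ p ∈ primesUpTo x, (p - 1) := by
  rw [powerClassCount, totient_radical, Ig,
    ← Finset.prod_filter_mul_prod_filter_not (primesUpTo x) (fun p : ℕ => (p : ℤ) ∣ g),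
    ← Finset.prod_filter_mul_prod_filter_not (primesUpTo x) (fun p : ℕ => (p : ℤ) ∣ g)
      (fun p => p - 1), filter_dvd_primesUpTo hg hx]
  have h1 : ∏ p ∈ g.natAbs.primeFactors, (powerResidues g p).card =
      2 ^ g.natAbs.primeFactors.card := by
    rw [← filter_dvd_primesUpTo hg hx]
    refine Finset.prod_eq_pow_card fun p hp => ?_
    obtain ⟨hp, hd⟩ := Finset.mem_filter.1 hp
    exact card_powerResidues_of_dvd (prime_of_mem_primesUpTo hp) hd
  have h2 : (∏ p ∈ (primesUpTo x).filter (fun p : ℕ => ¬ (p : ℤ) ∣ g), (powerResidues g p).card) *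
      ∏ p ∈ (primesUpTo x).filter (fun p : ℕ => ¬ (p : ℤ) ∣ g),
        (p - 1) / orderOf (g : ZMod p) =
      ∏ p ∈ (primesUpTo x).filter (fun p : ℕ => ¬ (p : ℤ) ∣ g), (p - 1) := by
    rw [← Finset.prod_mul_distrib]
    refine Finset.prod_congr rfl fun p hp => ?_
    obtain ⟨hp, hd⟩ := Finset.mem_filter.1 hp
    have hp := prime_of_mem_primesUpTo hp
    rw [card_powerResidues_of_not_dvd hp hd, Nat.mul_div_cancel' (orderOf_intCast_dvd_sub_one hp hd)]
  rw [h1, ← h2]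
  ring

lemma natCast_prod_sub_one (x : ℝ) :
    ((∏ p ∈ primesUpTo x, (p - 1) : ℕ) : ℝ) =
      Mx x * ∏ p ∈ primesUpTo x, (1 - (p : ℝ)⁻¹) := by
  rw [Mx, Nat.cast_prod, Nat.cast_prod, ← Finset.prod_mul_distrib]
  refine Finset.prod_congr rfl fun p hp => ?_
  have hp := prime_of_mem_primesUpTo hp
  have : (p : ℝ) ≠ 0 := by exact_mod_cast hp.ne_zero
  rw [Nat.cast_sub hp.one_le, Nat.cast_one]
  field_simp

lemma tendsto_pseudopowersIn_div_powerClassCount {g : ℤ} (hg : 2 ≤ |g|) :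
    Tendsto (fun x : ℝ => (pseudopowersIn g x 0 (Mx x) : ℝ) / powerClassCount g x) atTop
      (𝓝 1) := by
  have hg1 : g ≠ 1 := by rintro rfl; norm_num at hg
  have hlow := (tendsto_two_mul_floor_add_one_div_powerClassCount hg1).const_sub 1
  rw [sub_zero] at hlow
  refine tendsto_of_tendsto_of_tendsto_of_le_of_le' hlow tendsto_const_nhds ?_ ?_ <;>
    filter_upwards [eventually_ge_atTop 0] with x hx <;>
    obtain ⟨h1, h2⟩ := pseudopowersIn_bounds hg hx <;>
    have h0 : (0 : ℝ) < powerClassCount g x := by exact_mod_cast powerClassCount_pos g x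
  · have h2' : (powerClassCount g x : ℝ) ≤ pseudopowersIn g x 0 (Mx x) + (2 * ⌊x⌋₊ + 1) := by
      exact_mod_cast h2
    rw [sub_le_iff_le_add, ← add_div, le_div_iff₀ h0, one_mul]
    exact h2'
  · rw [div_le_one h0]
    exact_mod_cast h1

/-- For fixed `g` with `|g| ≥ 2`, as `x → ∞`,
`#(P_x ∩ (0, M(x)]) = (1+o(1)) · 2^{ω(g)} M(x) / (e^γ φ(rad(g)) I_g(x) log x)`. -/
theorem pseudopowers_count_asymptotic (g : ℤ) (hg : 2 ≤ |g|) :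
    ∀ ε : ℝ, 0 < ε → ∃ x₀ : ℝ, ∀ x : ℝ, x₀ ≤ x →
      |(pseudopowersIn g x 0 (Mx x) : ℝ) -
          2 ^ g.natAbs.primeFactors.card * (Mx x : ℝ) /
            (Real.exp Real.eulerMascheroniConstant * (Nat.totient (radical g) : ℝ) *
              (Ig g x : ℝ) * Real.log x)| ≤
        ε * (2 ^ g.natAbs.primeFactors.card * (Mx x : ℝ) /
            (Real.exp Real.eulerMascheroniConstant * (Nat.totient (radical g) : ℝ) *
              (Ig g x : ℝ) * Real.log x)) := by
  intro ε hε
  have hg0 : g ≠ 0 := by rintro rfl; norm_num at hg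
  have hmertens := tendsto_prod_primesUpTo_mul_log.const_mul
    (Real.exp Real.eulerMascheroniConstant)
  rw [← Real.exp_add, add_neg_cancel, Real.exp_zero] at hmertens
  have hlim := (tendsto_pseudopowersIn_div_powerClassCount hg).mul hmertens
  rw [one_mul] at hlim
  have hev := (Metric.tendsto_nhds.1 hlim ε hε).and
    ((eventually_ge_atTop (g.natAbs : ℝ)).and (eventually_ge_atTop 2))
  obtain ⟨x₀, hx₀⟩ := eventually_atTop.1 hev
  refine ⟨x₀, fun x hx => ?_⟩
  obtain ⟨hclose, hgx, hx2⟩ := hx₀ x hx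
  have hlog : 0 < Real.log x := Real.log_pos (by linarith)
  have hI : (0 : ℝ) < Ig g x := by exact_mod_cast Ig_pos g x
  have hT : (0 : ℝ) < powerClassCount g x := by exact_mod_cast powerClassCount_pos g x
  have hφ : (0 : ℝ) < Nat.totient (radical g) := by
    rw [Nat.cast_pos, Nat.totient_pos]
    exact Finset.prod_pos fun p hp => (Nat.prime_of_mem_primeFactors hp).pos
  have hP : 0 < ∏ p ∈ primesUpTo x, (1 - (p : ℝ)⁻¹) := by
    rw [prod_primesUpTo_eq_exp]
    exact Real.exp_pos _
  have hcount : (powerClassCount g x : ℝ) * (Nat.totient (radical g) * Ig g x) =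
      2 ^ g.natAbs.primeFactors.card * (Mx x * ∏ p ∈ primesUpTo x, (1 - (p : ℝ)⁻¹)) := by
    rw [← natCast_prod_sub_one]
    exact_mod_cast powerClassCount_mul_totient_mul_Ig hg0 hgx
  set P := ∏ p ∈ primesUpTo x, (1 - (p : ℝ)⁻¹)
  set main := 2 ^ g.natAbs.primeFactors.card * (Mx x : ℝ) /
            (Real.exp Real.eulerMascheroniConstant * (Nat.totient (radical g) : ℝ) *
              (Ig g x : ℝ) * Real.log x) with hmain
  have hE := Real.exp_pos Real.eulerMascheroniConstant
  have hTmain : (powerClassCount g x : ℝ) =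
      main * (Real.exp Real.eulerMascheroniConstant * (P * Real.log x)) := by
    rw [hmain, div_mul_eq_mul_div, eq_div_iff (by positivity)]
    linear_combination (Real.exp Real.eulerMascheroniConstant * Real.log x) * hcount
  have hmain0 : 0 < main := by
    have hq : 0 < Real.exp Real.eulerMascheroniConstant * (P * Real.log x) := by positivity
    exact pos_of_mul_pos_left (hTmain ▸ hT) hq.le
  have hratio : (pseudopowersIn g x 0 (Mx x) : ℝ) / powerClassCount g x *
      (Real.exp Real.eulerMascheroniConstant * (P * Real.log x)) =
      pseudopowersIn g x 0 (Mx x) / main := by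
    rw [hTmain]
    field_simp
  rw [hratio, Real.dist_eq, div_sub_one hmain0.ne', abs_div, abs_of_pos hmain0,
    div_lt_iff₀ hmain0] at hclose
  exact hclose.le
end
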